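/- arXiv:0804.1076 — 7 statements merged into one kernel-verified Lean document; each statement's English description precedes it below -/
import Mathlib

section
/- Let (G,m) be a finite connected weighted graph with normalised weights and suppose G is bipartite. Then for every μ ∈ ℝ, dim ker(Δ − μ) = dim ker(Δ − (2 − μ)). In particular μ is an eigenvalue of Δ if and only if 2 − μ is, with equal multiplicities. -/
open Finset

variable {V E : Type*}

/-- The weighted discrete Laplacian as a plain function:
`(ΔF)(v) = ρ(v) F(v) − (1/m(v))·(∑_{e : s e = v} m_e F(t e) + ∑_{e : t e = v} m_e F(s e))`,
where `ρ(v) = (∑_{e : s e = v} m_e + ∑_{e : t e = v} m_e)/m(v)`. -/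
noncomputable def lapFun [Fintype E] [DecidableEq V] (s t : E → V) (mV : V → ℝ) (mE : E → ℝ)
    (F : V → ℂ) : V → ℂ := fun v =>
  ((((∑ e ∈ univ.filter fun e => s e = v, mE e) +
      ∑ e ∈ univ.filter fun e => t e = v, mE e) / mV v : ℝ) : ℂ) * F v -
    (1 / (mV v : ℂ)) *
      ((∑ e ∈ univ.filter fun e => s e = v, (mE e : ℂ) * F (t e)) +
        ∑ e ∈ univ.filter fun e => t e = v, (mE e : ℂ) * F (s e))

/-- The weighted discrete Laplacian as a linear endomorphism of `V → ℂ`. -/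
noncomputable def lap [Fintype E] [DecidableEq V] (s t : E → V) (mV : V → ℝ) (mE : E → ℝ) :
    (V → ℂ) →ₗ[ℂ] (V → ℂ) where
  toFun := lapFun s t mV mE
  map_add' F G := by
    funext v
    simp only [lapFun, Pi.add_apply, mul_add, Finset.sum_add_distrib]
    ring
  map_smul' c F := by
    funext v
    have h1 : (∑ e ∈ univ.filter fun e => s e = v, (mE e : ℂ) * (c * F (t e))) =
        c * ∑ e ∈ univ.filter fun e => s e = v, (mE e : ℂ) * F (t e) := by
      rw [Finset.mul_sum]; exact Finset.sum_congr rfl fun e _ => by ring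
    have h2 : (∑ e ∈ univ.filter fun e => t e = v, (mE e : ℂ) * (c * F (s e))) =
        c * ∑ e ∈ univ.filter fun e => t e = v, (mE e : ℂ) * F (s e) := by
      rw [Finset.mul_sum]; exact Finset.sum_congr rfl fun e _ => by ring
    simp only [lapFun, Pi.smul_apply, smul_eq_mul, RingHom.id_apply, h1, h2]
    ring

/-- Multiplication by a function that changes sign along every edge intertwines the normalised
Laplacian `Δ` with `2 - Δ`. -/
theorem lap_mul_of_alternating [Fintype E] [DecidableEq V]
    (s t : E → V) (mV : V → ℝ) (mE : E → ℝ) (hmV : ∀ v, 0 < mV v)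
    (hnorm : ∀ v, (∑ e ∈ univ.filter fun e => s e = v, mE e) +
        (∑ e ∈ univ.filter fun e => t e = v, mE e) = mV v)
    (ε : V → ℂ) (hε : ∀ e, ε (t e) = -ε (s e)) (F : V → ℂ) :
    lap s t mV mE (ε * F) = ε * ((2 : ℂ) • F - lap s t mV mE F) := by
  funext v
  have hs : (∑ e ∈ univ.filter fun e => s e = v, (mE e : ℂ) * (ε * F) (t e)) =
      -ε v * ∑ e ∈ univ.filter fun e => s e = v, (mE e : ℂ) * F (t e) := by
    rw [Finset.mul_sum]
    refine Finset.sum_congr rfl fun e he => ?_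
    rw [Pi.mul_apply, hε, (Finset.mem_filter.mp he).2]
    ring
  have ht : (∑ e ∈ univ.filter fun e => t e = v, (mE e : ℂ) * (ε * F) (s e)) =
      -ε v * ∑ e ∈ univ.filter fun e => t e = v, (mE e : ℂ) * F (s e) := by
    rw [Finset.mul_sum]
    refine Finset.sum_congr rfl fun e he => ?_
    rw [Pi.mul_apply, ← neg_eq_iff_eq_neg.mpr (hε e), (Finset.mem_filter.mp he).2]
    ring
  change lapFun s t mV mE (ε * F) v = ε v * (2 * F v - lapFun s t mV mE F v)
  rw [lapFun, lapFun, hs, ht, hnorm, div_self (hmV v).ne', Pi.mul_apply, Complex.ofReal_one]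
  ring

/-- An eigenspace of the normalised Laplacian of a bipartite graph embeds into the eigenspace of
the reflected eigenvalue. -/
theorem finrank_ker_lap_sub_le_of_bipartite [Fintype V] [Fintype E] [DecidableEq V]
    (s t : E → V) (mV : V → ℝ) (mE : E → ℝ) (hmV : ∀ v, 0 < mV v)
    (hnorm : ∀ v, (∑ e ∈ univ.filter fun e => s e = v, mE e) +
        (∑ e ∈ univ.filter fun e => t e = v, mE e) = mV v)
    (hbip : ∃ A : Set V, ∀ e, Xor (s e ∈ A) (t e ∈ A)) (μ : ℂ) :
    Module.finrank ℂ
        (LinearMap.ker (lap s t mV mE - μ • (LinearMap.id : (V → ℂ) →ₗ[ℂ] (V → ℂ)))) ≤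
      Module.finrank ℂ
        (LinearMap.ker (lap s t mV mE - (2 - μ) • (LinearMap.id : (V → ℂ) →ₗ[ℂ] (V → ℂ)))) := by
  classical
  obtain ⟨A, hA⟩ := hbip
  let ε : V → ℂ := fun v => if v ∈ A then 1 else -1
  have hε : ∀ e, ε (t e) = -ε (s e) := fun e => by
    rcases hA e with ⟨h₁, h₂⟩ | ⟨h₁, h₂⟩ <;> simp [ε, h₁, h₂]
  have hεsq : ε * ε = 1 := by
    funext v
    by_cases h : v ∈ A <;> simp [ε, h]
  have hinj : Function.Injective (LinearMap.mulLeft ℂ ε) :=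
    Function.LeftInverse.injective (g := LinearMap.mulLeft ℂ ε) fun F => by
      simp only [LinearMap.mulLeft_apply, ← mul_assoc, hεsq, one_mul]
  refine LinearMap.finrank_le_finrank_of_injective
    (f := (LinearMap.mulLeft ℂ ε).restrict fun F hF => ?_) fun F G h =>
      Subtype.ext (hinj (congrArg Subtype.val h))
  have hF' : lap s t mV mE F = μ • F := by
    simpa [sub_eq_zero] using hF
  simp only [LinearMap.mem_ker, LinearMap.sub_apply, LinearMap.smul_apply, LinearMap.id_apply,
    LinearMap.mulLeft_apply, lap_mul_of_alternating s t mV mE hmV hnorm ε hε, hF']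
  rw [← sub_smul, mul_smul_comm, sub_self]

/-- **Spectral symmetry for bipartite graphs.**
For a finite connected weighted bipartite graph with normalised weights, the
spectrum of the weighted Laplacian is symmetric under `μ ↦ 2 − μ`, with equal
multiplicities: `dim ker (Δ − μ) = dim ker (Δ − (2 − μ))`. -/
theorem bipartite_spectral_symmetry
    [Fintype V] [Fintype E] [DecidableEq V] [Nonempty V]
    (s t : E → V) (mV : V → ℝ) (mE : E → ℝ)
    (hmV : ∀ v, 0 < mV v) (hmE : ∀ e, 0 < mE e)
    (hnorm : ∀ v, (∑ e ∈ univ.filter fun e => s e = v, mE e) +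
        (∑ e ∈ univ.filter fun e => t e = v, mE e) = mV v)
    (hconn : ∀ v w : V, Relation.EqvGen (fun a b => ∃ e, s e = a ∧ t e = b) v w)
    (hbip : ∃ A : Set V, ∀ e, Xor' (s e ∈ A) (t e ∈ A))
    (μ : ℝ) :
    Module.finrank ℂ
        (LinearMap.ker (lap s t mV mE - (μ : ℂ) • (LinearMap.id : (V → ℂ) →ₗ[ℂ] (V → ℂ)))) =
      Module.finrank ℂ
        (LinearMap.ker (lap s t mV mE -
          ((2 - μ : ℝ) : ℂ) • (LinearMap.id : (V → ℂ) →ₗ[ℂ] (V → ℂ)))) := by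
  rw [show ((2 - μ : ℝ) : ℂ) = 2 - (μ : ℂ) by push_cast; rfl]
  have hle := finrank_ker_lap_sub_le_of_bipartite s t mV mE hmV hnorm hbip
  refine le_antisymm (hle μ) ?_
  have hge := hle (2 - μ)
  rwa [sub_sub_cancel] at hge
end

section
/- Let (G,m) be a finite connected weighted graph with normalised weights. Then 2 is an eigenvalue of the weighted Laplacian Δ if and only if G is bipartite; moreover, if G is bipartite then dim ker(Δ − 2) = 1. -/
open Finset

variable {V E : Type*}

/-- With normalised weights, `F` is in the `2`-eigenspace iff at each vertex the weighted sum of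
`F (s e) + F (t e)` over the incidences vanishes. -/
theorem mem_eigenspace_two_iff_sum [Fintype E] [DecidableEq V]
    {s t : E → V} {mV : V → ℝ} {mE : E → ℝ} (hmV : ∀ v, 0 < mV v)
    (hnorm : ∀ v, (∑ e ∈ univ.filter fun e => s e = v, mE e) +
        (∑ e ∈ univ.filter fun e => t e = v, mE e) = mV v) {F : V → ℂ} :
    F ∈ Module.End.eigenspace (lap s t mV mE) 2 ↔ ∀ v,
      (∑ e ∈ univ.filter fun e => s e = v, (mE e : ℂ) * (F (s e) + F (t e))) +
        (∑ e ∈ univ.filter fun e => t e = v, (mE e : ℂ) * (F (s e) + F (t e))) = 0 := by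
  rw [Module.End.mem_eigenspace_iff, funext_iff]
  refine forall_congr' fun v => ?_
  have hv : (mV v : ℂ) ≠ 0 := by exact_mod_cast (hmV v).ne'
  have hs : (∑ e ∈ univ.filter fun e => s e = v, (mE e : ℂ) * (F (s e) + F (t e))) =
      (∑ e ∈ univ.filter fun e => s e = v, (mE e : ℂ)) * F v +
        ∑ e ∈ univ.filter fun e => s e = v, (mE e : ℂ) * F (t e) := by
    rw [sum_mul, ← sum_add_distrib]
    refine sum_congr rfl fun e he => ?_
    rw [(mem_filter.1 he).2, mul_add]
  have ht : (∑ e ∈ univ.filter fun e => t e = v, (mE e : ℂ) * (F (s e) + F (t e))) =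
      (∑ e ∈ univ.filter fun e => t e = v, (mE e : ℂ)) * F v +
        ∑ e ∈ univ.filter fun e => t e = v, (mE e : ℂ) * F (s e) := by
    rw [sum_mul, ← sum_add_distrib]
    refine sum_congr rfl fun e he => ?_
    rw [(mem_filter.1 he).2, mul_add, add_comm]
  have hn : (∑ e ∈ univ.filter fun e => s e = v, (mE e : ℂ)) +
      (∑ e ∈ univ.filter fun e => t e = v, (mE e : ℂ)) = mV v := by
    exact_mod_cast hnorm v
  have hlap : lap s t mV mE F v = F v - (1 / (mV v : ℂ)) *
      ((∑ e ∈ univ.filter fun e => s e = v, (mE e : ℂ) * F (t e)) +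
        ∑ e ∈ univ.filter fun e => t e = v, (mE e : ℂ) * F (s e)) := by
    change lapFun s t mV mE F v = _
    rw [lapFun, hnorm v, div_self (hmV v).ne', Complex.ofReal_one, one_mul]
  rw [hlap, hs, ht, Pi.smul_apply, smul_eq_mul]
  field_simp
  constructor <;> intro h <;> linear_combination F v * hn - h

/-- The `2`-eigenfunctions are exactly the functions changing sign along every edge. -/
theorem mem_eigenspace_two_iff [Fintype V] [Fintype E] [DecidableEq V]
    {s t : E → V} {mV : V → ℝ} {mE : E → ℝ} (hmV : ∀ v, 0 < mV v) (hmE : ∀ e, 0 < mE e)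
    (hnorm : ∀ v, (∑ e ∈ univ.filter fun e => s e = v, mE e) +
        (∑ e ∈ univ.filter fun e => t e = v, mE e) = mV v) {F : V → ℂ} :
    F ∈ Module.End.eigenspace (lap s t mV mE) 2 ↔ ∀ e, F (t e) = -F (s e) := by
  rw [mem_eigenspace_two_iff_sum hmV hnorm]
  constructor
  · intro h
    have key (r : E → V) : ∑ v, starRingEnd ℂ (F v) *
          (∑ e ∈ univ.filter fun e => r e = v, (mE e : ℂ) * (F (s e) + F (t e))) =
        ∑ e, starRingEnd ℂ (F (r e)) * ((mE e : ℂ) * (F (s e) + F (t e))) := by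
      rw [← sum_fiberwise univ r]
      refine sum_congr rfl fun v _ => ?_
      rw [mul_sum]
      exact sum_congr rfl fun e he => by rw [(mem_filter.1 he).2]
    have hsum : ∑ e, mE e * Complex.normSq (F (s e) + F (t e)) = 0 := by
      rw [← Complex.ofReal_inj]
      push_cast
      calc ∑ e, (mE e : ℂ) * (Complex.normSq (F (s e) + F (t e)) : ℂ)
          = ∑ e, starRingEnd ℂ (F (s e)) * ((mE e : ℂ) * (F (s e) + F (t e))) +
            ∑ e, starRingEnd ℂ (F (t e)) * ((mE e : ℂ) * (F (s e) + F (t e))) := by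
            rw [← sum_add_distrib]
            refine sum_congr rfl fun e _ => ?_
            rw [Complex.normSq_eq_conj_mul_self, map_add]
            ring
        _ = 0 := by
            rw [← key s, ← key t, ← sum_add_distrib]
            refine sum_eq_zero fun v _ => ?_
            rw [← mul_add, h v, mul_zero]
    intro e
    have he := (sum_eq_zero_iff_of_nonneg fun e _ =>
      mul_nonneg (hmE e).le (Complex.normSq_nonneg _)).1 hsum e (mem_univ e)
    have := Complex.normSq_eq_zero.1 ((mul_eq_zero.1 he).resolve_left (hmE e).ne')
    exact eq_neg_of_add_eq_zero_right this
  · intro h v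
    simp [h]

/-- A function that is constant along edges is constant on a connected graph. -/
theorem eq_of_forall_edge_eq {α : Type*} {s t : E → V} {f : V → α}
    (hf : ∀ e, f (t e) = f (s e)) {v w : V}
    (h : Relation.EqvGen (fun a b => ∃ e, s e = a ∧ t e = b) v w) : f v = f w := by
  induction h with
  | rel _ _ h => obtain ⟨e, rfl, rfl⟩ := h; exact (hf e).symm
  | refl => rfl
  | symm _ _ _ ih => exact ih.symm
  | trans _ _ _ _ _ ih₁ ih₂ => exact ih₁.trans ih₂

/-- **Spectral characterisation of bipartiteness.**
For a finite connected weighted graph with normalised weights, `2` is an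
eigenvalue of the weighted Laplacian iff the graph is bipartite, and in the
bipartite case the eigenvalue `2` is simple: `dim ker (Δ − 2) = 1`. -/
theorem bipartite_iff_two_eigenvalue
    [Fintype V] [Fintype E] [DecidableEq V] [Nonempty V]
    (s t : E → V) (mV : V → ℝ) (mE : E → ℝ)
    (hmV : ∀ v, 0 < mV v) (hmE : ∀ e, 0 < mE e)
    (hnorm : ∀ v, (∑ e ∈ univ.filter fun e => s e = v, mE e) +
        (∑ e ∈ univ.filter fun e => t e = v, mE e) = mV v)
    (hconn : ∀ v w : V, Relation.EqvGen (fun a b => ∃ e, s e = a ∧ t e = b) v w) :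
    (Module.End.HasEigenvalue (lap s t mV mE) 2 ↔
      ∃ A : Set V, ∀ e, Xor' (s e ∈ A) (t e ∈ A)) ∧
    ((∃ A : Set V, ∀ e, Xor' (s e ∈ A) (t e ∈ A)) →
      Module.finrank ℂ (Module.End.eigenspace (lap s t mV mE) 2) = 1) := by
  have hmem {F : V → ℂ} := mem_eigenspace_two_iff (F := F) hmV hmE hnorm
  have hsign : (∃ A : Set V, ∀ e, Xor (s e ∈ A) (t e ∈ A)) →
      ∃ σ : V → ℂ, (∀ v, σ v * σ v = 1) ∧ ∀ e, σ (t e) = -σ (s e) := by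
    classical
    rintro ⟨A, hA⟩
    refine ⟨fun v => if v ∈ A then 1 else -1, fun v => ?_, fun e => ?_⟩
    · dsimp only
      split_ifs <;> norm_num
    · rcases hA e with ⟨h₁, h₂⟩ | ⟨h₁, h₂⟩ <;> simp [h₁, h₂]
  have hne {σ : V → ℂ} (hσ : ∀ v, σ v * σ v = 1) : σ ≠ 0 := by
    rintro rfl
    simpa using hσ (Classical.arbitrary V)
  refine ⟨⟨fun h => ?_, fun h => ?_⟩, fun h => ?_⟩
  · obtain ⟨F, hF, hF0⟩ := h.exists_hasEigenvector
    rw [hmem] at hF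
    obtain ⟨v₀, hv₀⟩ := Function.ne_iff.1 hF0
    have hsq (v : V) : F v = F v₀ ∨ F v = -F v₀ :=
      sq_eq_sq_iff_eq_or_eq_neg.1 <|
        eq_of_forall_edge_eq (f := fun v => F v ^ 2) (fun e => by simp [hF e]) (hconn v v₀)
    refine ⟨{v | F v = F v₀}, fun e => ?_⟩
    have hneg : -F v₀ ≠ F v₀ := fun h => hv₀ (self_eq_neg.1 h.symm)
    rcases hsq (s e) with h | h
    · exact Or.inl ⟨h, by simpa [hF e, h] using hneg⟩
    · exact Or.inr ⟨by simp [hF e, h], by simpa [h] using hneg⟩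
  · obtain ⟨σ, hσ, hσe⟩ := hsign h
    exact Module.End.hasEigenvalue_of_hasEigenvector ⟨hmem.2 hσe, hne hσ⟩
  · obtain ⟨σ, hσ, hσe⟩ := hsign h
    refine (finrank_eq_one_iff_of_nonzero'
      (⟨σ, hmem.2 hσe⟩ : Module.End.eigenspace (lap s t mV mE) 2)
      (fun h0 => hne hσ (congrArg Subtype.val h0))).2 ?_
    rintro ⟨F, hF⟩
    rw [hmem] at hF
    let v₀ := Classical.arbitrary V
    refine ⟨F v₀ * σ v₀, Subtype.ext (funext fun v => ?_)⟩
    have hconst : F v * σ v = F v₀ * σ v₀ :=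
      eq_of_forall_edge_eq (f := fun v => F v * σ v) (fun e => by simp [hF e, hσe e])
        (hconn v v₀)
    change F v₀ * σ v₀ * σ v = F v
    rw [← hconst, mul_assoc, hσ, mul_one]
end

section
/- Let (G,m) be a finite connected weighted graph with normalised weights which is bipartite, and let ∂V ⊆ V be a boundary set with V∖∂V nonempty. Then for every μ ∈ ℝ, dim ker(Δ^{∂V} − μ) = dim ker(Δ^{∂V} − (2 − μ)); i.e. the spectrum of the Dirichlet Laplacian is symmetric under μ ↦ 2 − μ, with multiplicities preserved. -/
open Finset

variable {V E : Type*}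

/-- The subspace `{F : V → ℂ | F ≡ 0 on ∂V}` of functions vanishing on the boundary. -/
noncomputable def dirDom [DecidableEq V] (bd : Finset V) : Submodule ℂ (V → ℂ) where
  carrier := {F | ∀ v ∈ bd, F v = 0}
  add_mem' := fun {F G} hF hG v hv => by simp [hF v hv, hG v hv]
  zero_mem' := fun v _ => rfl
  smul_mem' := fun c F hF v hv => by simp [hF v hv]

/-- Restriction of functions, setting the values on `bd` to zero. -/
noncomputable def zeroOut [DecidableEq V] (bd : Finset V) : (V → ℂ) →ₗ[ℂ] (V → ℂ) where
  toFun F := fun v => if v ∈ bd then 0 else F v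
  map_add' F G := by funext v; by_cases h : v ∈ bd <;> simp [h]
  map_smul' c F := by funext v; by_cases h : v ∈ bd <;> simp [h]

/-- The discrete Dirichlet Laplacian `Δ^{∂V}` as an endomorphism of the space of
functions vanishing on `∂V`; it is given by the Laplacian formula at the inner
vertices. -/
noncomputable def dirLap [Fintype E] [DecidableEq V] (s t : E → V) (mV : V → ℝ) (mE : E → ℝ)
    (bd : Finset V) : dirDom (V := V) bd →ₗ[ℂ] dirDom (V := V) bd :=
  LinearMap.codRestrict (dirDom bd)
    ((zeroOut bd).comp ((lap s t mV mE).comp (dirDom (V := V) bd).subtype))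
    (fun F => by intro v hv; simp [zeroOut, hv])

/-- Multiplication by a `±1`-valued function, as an automorphism of the functions vanishing
on `bd`. -/
noncomputable def signEquiv [DecidableEq V] (bd : Finset V) (σ : V → ℂ) (hσ : ∀ v, σ v * σ v = 1) :
    dirDom (V := V) bd ≃ₗ[ℂ] dirDom (V := V) bd :=
  LinearEquiv.ofInvolutive
    { toFun := fun F => ⟨fun v => σ v * F.1 v, fun v hv => by simp [F.2 v hv]⟩
      map_add' := fun F G => by ext v; simp [mul_add]
      map_smul' := fun c F => by ext v; simp [mul_left_comm] }
    (fun F => by ext v; simp [← mul_assoc, hσ v])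

theorem signEquiv_apply [DecidableEq V] (bd : Finset V) (σ : V → ℂ) (hσ : ∀ v, σ v * σ v = 1)
    (F : dirDom (V := V) bd) : (signEquiv bd σ hσ F).1 = fun v => σ v * F.1 v := rfl

theorem dirLap_apply [Fintype E] [DecidableEq V] (s t : E → V) (mV : V → ℝ) (mE : E → ℝ)
    (bd : Finset V) (F : dirDom (V := V) bd) (v : V) :
    (dirLap s t mV mE bd F).1 v = if v ∈ bd then 0 else lapFun s t mV mE F.1 v := rfl

/-- For normalised weights, multiplication by a function that changes sign along every edge
turns the Laplacian `Δ` into `2 - Δ`. -/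
theorem lapFun_sign_mul [Fintype E] [DecidableEq V] (s t : E → V) (mV : V → ℝ) (mE : E → ℝ)
    (hmV : ∀ v, 0 < mV v)
    (hnorm : ∀ v, (∑ e ∈ univ.filter fun e => s e = v, mE e) +
        (∑ e ∈ univ.filter fun e => t e = v, mE e) = mV v)
    (σ : V → ℂ) (hedge : ∀ e, σ (t e) = -σ (s e)) (F : V → ℂ) (v : V) :
    lapFun s t mV mE (fun w => σ w * F w) v = σ v * (2 * F v - lapFun s t mV mE F v) := by
  have hs : (∑ e ∈ univ.filter fun e => s e = v, (mE e : ℂ) * (σ (t e) * F (t e))) =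
      -σ v * ∑ e ∈ univ.filter fun e => s e = v, (mE e : ℂ) * F (t e) := by
    rw [Finset.mul_sum]
    refine Finset.sum_congr rfl fun e he => ?_
    rw [hedge, (Finset.mem_filter.mp he).2]
    ring
  have ht : (∑ e ∈ univ.filter fun e => t e = v, (mE e : ℂ) * (σ (s e) * F (s e))) =
      -σ v * ∑ e ∈ univ.filter fun e => t e = v, (mE e : ℂ) * F (s e) := by
    rw [Finset.mul_sum]
    refine Finset.sum_congr rfl fun e he => ?_
    rw [← (Finset.mem_filter.mp he).2, hedge]
    ring
  simp only [lapFun, hs, ht, hnorm, div_self (hmV v).ne', Complex.ofReal_one]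
  ring

/-- If an automorphism `S` satisfies `L S = S (2 - L)`, it maps the `μ`-eigenspace of `L` onto
its `(2 - μ)`-eigenspace. -/
theorem finrank_ker_sub_smul_id_eq {M : Type*} [AddCommGroup M] [Module ℂ M]
    (L : M →ₗ[ℂ] M) (S : M ≃ₗ[ℂ] M) (h : ∀ x, L (S x) = S ((2 : ℂ) • x - L x)) (μ : ℂ) :
    Module.finrank ℂ (LinearMap.ker (L - μ • LinearMap.id)) =
      Module.finrank ℂ (LinearMap.ker (L - (2 - μ) • LinearMap.id)) := by
  have key : LinearMap.ker (L - μ • LinearMap.id) =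
      (LinearMap.ker (L - (2 - μ) • LinearMap.id)).comap (S : M →ₗ[ℂ] M) := by
    ext x
    have hx : L (S x) - (2 - μ) • S x = -S (L x - μ • x) := by
      rw [h]
      simp only [map_sub, map_smul]
      module
    change L x - μ • x = 0 ↔ L (S x) - (2 - μ) • S x = 0
    rw [hx, neg_eq_zero, S.map_eq_zero_iff]
  exact key ▸ (S.ofSubmodule' _).finrank_eq

/-- **Spectral symmetry of the Dirichlet Laplacian for bipartite graphs.**
For a finite connected weighted bipartite graph with normalised weights and a
boundary set `∂V` with nonempty complement, the spectrum of the Dirichlet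
Laplacian is symmetric under `μ ↦ 2 − μ`, with multiplicities preserved. -/
theorem bipartite_dirichlet_spectral_symmetry
    [Fintype V] [Fintype E] [DecidableEq V] [Nonempty V]
    (s t : E → V) (mV : V → ℝ) (mE : E → ℝ)
    (hmV : ∀ v, 0 < mV v) (hmE : ∀ e, 0 < mE e)
    (hnorm : ∀ v, (∑ e ∈ univ.filter fun e => s e = v, mE e) +
        (∑ e ∈ univ.filter fun e => t e = v, mE e) = mV v)
    (hconn : ∀ v w : V, Relation.EqvGen (fun a b => ∃ e, s e = a ∧ t e = b) v w)
    (hbip : ∃ A : Set V, ∀ e, Xor' (s e ∈ A) (t e ∈ A))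
    (bd : Finset V) (hbd : ∃ v : V, v ∉ bd)
    (μ : ℝ) :
    Module.finrank ℂ
        (LinearMap.ker (dirLap s t mV mE bd -
          (μ : ℂ) • (LinearMap.id : dirDom (V := V) bd →ₗ[ℂ] dirDom (V := V) bd))) =
      Module.finrank ℂ
        (LinearMap.ker (dirLap s t mV mE bd -
          ((2 - μ : ℝ) : ℂ) • (LinearMap.id : dirDom (V := V) bd →ₗ[ℂ] dirDom (V := V) bd))) := by
  obtain ⟨A, hA⟩ := hbip
  classical
  let σ : V → ℂ := fun v => if v ∈ A then 1 else -1
  have hσ : ∀ v, σ v * σ v = 1 := fun v => by by_cases h : v ∈ A <;> simp [σ, h]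
  have hedge : ∀ e, σ (t e) = -σ (s e) := fun e => by
    rcases hA e with ⟨h₁, h₂⟩ | ⟨h₁, h₂⟩ <;> simp [σ, h₁, h₂]
  have hconj : ∀ F, dirLap s t mV mE bd (signEquiv bd σ hσ F) =
      signEquiv bd σ hσ ((2 : ℂ) • F - dirLap s t mV mE bd F) := fun F => by
    ext v
    rw [dirLap_apply, signEquiv_apply, signEquiv_apply]
    by_cases hv : v ∈ bd
    · simp [hv, dirLap_apply, F.2 v hv]
    · have hF := lapFun_sign_mul s t mV mE hmV hnorm σ hedge F.1 v
      simpa only [hv, dirLap_apply, if_false, Submodule.coe_sub, Submodule.coe_smul,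
        Pi.sub_apply, Pi.smul_apply, smul_eq_mul] using hF
  rw [show ((2 - μ : ℝ) : ℂ) = 2 - (μ : ℂ) by push_cast; rfl]
  exact finrank_ker_sub_smul_id_eq _ (signEquiv bd σ hσ) hconj μ
end

section
/- Let G be a finite connected graph and set β = 1 if G is bipartite and β = 0 otherwise. Then the unoriented boundary map ∂̄ : ℂ^E → ℂ^V satisfies dim ker ∂̄ = |E| − |V| + β (and its cokernel has dimension β). -/
open Finset

variable {V E : Type*}

/-- The oriented boundary map `∂ : ℂ^E → ℂ^V`,
`(∂η)(v) = ∑_{e : t e = v} η_e − ∑_{e : s e = v} η_e`. -/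
noncomputable def bdry [Fintype E] [DecidableEq V] (s t : E → V) :
    (E → ℂ) →ₗ[ℂ] (V → ℂ) where
  toFun η := fun v => (∑ e ∈ univ.filter fun e => t e = v, η e) -
      ∑ e ∈ univ.filter fun e => s e = v, η e
  map_add' η ξ := by
    funext v
    simp only [Pi.add_apply, Finset.sum_add_distrib]
    ring
  map_smul' c η := by
    funext v
    simp only [Pi.smul_apply, smul_eq_mul, RingHom.id_apply, ← Finset.mul_sum]
    ring

/-- The unoriented boundary map `∂̄ : ℂ^E → ℂ^V`,
`(∂̄η)(v) = ∑_{e : t e = v} η_e + ∑_{e : s e = v} η_e`. -/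
noncomputable def unorBdry [Fintype E] [DecidableEq V] (s t : E → V) :
    (E → ℂ) →ₗ[ℂ] (V → ℂ) where
  toFun η := fun v => (∑ e ∈ univ.filter fun e => t e = v, η e) +
      ∑ e ∈ univ.filter fun e => s e = v, η e
  map_add' η ξ := by
    funext v
    simp only [Pi.add_apply, Finset.sum_add_distrib]
    ring
  map_smul' c η := by
    funext v
    simp only [Pi.smul_apply, smul_eq_mul, RingHom.id_apply, ← Finset.mul_sum]
    ring

/-- The relative oriented boundary map `∂^{rel} : ℂ^E → ℂ^{V∖∂V}`. -/
noncomputable def relBdry [Fintype E] [DecidableEq V] (s t : E → V) (bd : Finset V) :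
    (E → ℂ) →ₗ[ℂ] ({v : V // v ∉ bd} → ℂ) where
  toFun η := fun w => (∑ e ∈ univ.filter fun e => t e = w.val, η e) -
      ∑ e ∈ univ.filter fun e => s e = w.val, η e
  map_add' η ξ := by
    funext w
    simp only [Pi.add_apply, Finset.sum_add_distrib]
    ring
  map_smul' c η := by
    funext w
    simp only [Pi.smul_apply, smul_eq_mul, RingHom.id_apply, ← Finset.mul_sum]
    ring

/-- The relative unoriented boundary map `∂̄^{rel} : ℂ^E → ℂ^{V∖∂V}`. -/
noncomputable def relUnorBdry [Fintype E] [DecidableEq V] (s t : E → V) (bd : Finset V) :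
    (E → ℂ) →ₗ[ℂ] ({v : V // v ∉ bd} → ℂ) where
  toFun η := fun w => (∑ e ∈ univ.filter fun e => t e = w.val, η e) +
      ∑ e ∈ univ.filter fun e => s e = w.val, η e
  map_add' η ξ := by
    funext w
    simp only [Pi.add_apply, Finset.sum_add_distrib]
    ring
  map_smul' c η := by
    funext w
    simp only [Pi.smul_apply, smul_eq_mul, RingHom.id_apply, ← Finset.mul_sum]
    ring

/-- A function which takes the same value at both ends of every edge of a connected graph is
constant. -/
theorem eq_of_eqvGen_edge {α : Type*} {s t : E → V} {g : V → α} (hg : ∀ e, g (s e) = g (t e))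
    {v w : V} (h : Relation.EqvGen (fun a b => ∃ e, s e = a ∧ t e = b) v w) : g v = g w := by
  induction h with
  | rel a b hab =>
    obtain ⟨e, rfl, rfl⟩ := hab
    exact hg e
  | refl => rfl
  | symm _ _ _ ih => exact ih.symm
  | trans _ _ _ _ _ ih₁ ih₂ => exact ih₁.trans ih₂

/-- The unoriented incidence matrix, in which a loop is counted twice. -/
def unorIncMatrix [DecidableEq V] (s t : E → V) : Matrix V E ℂ :=
  Matrix.of fun v e => (if t e = v then 1 else 0) + if s e = v then 1 else 0

theorem mulVecLin_unorIncMatrix [Fintype E] [DecidableEq V] (s t : E → V) :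
    (unorIncMatrix s t).mulVecLin = unorBdry s t := by
  refine LinearMap.ext fun η => funext fun v => ?_
  simp [unorIncMatrix, unorBdry, Matrix.mulVec, dotProduct, add_mul, Finset.sum_add_distrib,
    Finset.sum_filter]

theorem mem_ker_transpose_unorIncMatrix [Fintype V] [DecidableEq V] (s t : E → V) (f : V → ℂ) :
    f ∈ LinearMap.ker (unorIncMatrix s t).transpose.mulVecLin ↔ ∀ e, f (t e) + f (s e) = 0 := by
  simp [unorIncMatrix, Matrix.vecMul, dotProduct, mul_add, Finset.sum_add_distrib, funext_iff]

/-- The cokernel of the unoriented boundary map has the dimension of the kernel of its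
transpose. -/
theorem finrank_coker_unorBdry [Fintype V] [Fintype E] [DecidableEq V] (s t : E → V) :
    Module.finrank ℂ ((V → ℂ) ⧸ LinearMap.range (unorBdry s t)) =
      Module.finrank ℂ (LinearMap.ker (unorIncMatrix s t).transpose.mulVecLin) := by
  have h₁ := (LinearMap.range (unorBdry s t)).finrank_quotient_add_finrank
  have h₂ := (unorIncMatrix s t).transpose.mulVecLin.finrank_range_add_finrank_ker
  have h₃ : Module.finrank ℂ (LinearMap.range (unorIncMatrix s t).transpose.mulVecLin) =
      Module.finrank ℂ (LinearMap.range (unorBdry s t)) := by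
    rw [← mulVecLin_unorIncMatrix]
    exact (unorIncMatrix s t).rank_transpose
  omega

theorem finrank_ker_unorBdry [Fintype V] [Fintype E] [DecidableEq V] (s t : E → V) :
    (Module.finrank ℂ (LinearMap.ker (unorBdry s t)) : ℤ) =
      (Fintype.card E : ℤ) - Fintype.card V +
        Module.finrank ℂ ((V → ℂ) ⧸ LinearMap.range (unorBdry s t)) := by
  have h₁ := (LinearMap.range (unorBdry s t)).finrank_quotient_add_finrank
  have h₂ := (unorBdry s t).finrank_range_add_finrank_ker
  rw [Module.finrank_fintype_fun_eq_card] at h₁ h₂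
  omega

theorem finrank_coker_unorBdry_of_bipartite [Fintype V] [Fintype E] [DecidableEq V] [Nonempty V]
    {s t : E → V}
    (hconn : ∀ v w : V, Relation.EqvGen (fun a b => ∃ e, s e = a ∧ t e = b) v w)
    (hbip : ∃ A : Set V, ∀ e, Xor (s e ∈ A) (t e ∈ A)) :
    Module.finrank ℂ ((V → ℂ) ⧸ LinearMap.range (unorBdry s t)) = 1 := by
  classical
  obtain ⟨A, hA⟩ := hbip
  obtain ⟨v₀⟩ := ‹Nonempty V›
  let σ : V → ℂ := fun v => if v ∈ A then 1 else -1
  have hσ : ∀ e, σ (t e) = -σ (s e) := fun e => by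
    rcases hA e with ⟨h, h'⟩ | ⟨h, h'⟩ <;> simp [σ, h, h']
  have hσσ : ∀ v, σ v * σ v = 1 := fun v => by
    by_cases h : v ∈ A <;> simp [σ, h]
  rw [finrank_coker_unorBdry]
  refine finrank_eq_one_iff'.2 ⟨⟨σ, ?_⟩, ?_, ?_⟩
  · exact (mem_ker_transpose_unorIncMatrix s t σ).2 fun e => by rw [hσ]; ring
  · intro h
    have h₀ : σ v₀ = 0 := congrFun (congrArg Subtype.val h) v₀
    simpa [h₀] using hσσ v₀
  · rintro ⟨f, hf⟩
    rw [mem_ker_transpose_unorIncMatrix] at hf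
    refine ⟨f v₀ * σ v₀, Subtype.ext (funext fun v => ?_)⟩
    have h : f v₀ * σ v₀ = f v * σ v :=
      eq_of_eqvGen_edge (g := fun v => f v * σ v)
        (fun e => by simp only [hσ, eq_neg_of_add_eq_zero_left (hf e), neg_mul_neg]) (hconn v₀ v)
    change f v₀ * σ v₀ * σ v = f v
    rw [h, mul_assoc, hσσ, mul_one]

theorem finrank_coker_unorBdry_of_not_bipartite [Fintype V] [Fintype E] [DecidableEq V]
    {s t : E → V}
    (hconn : ∀ v w : V, Relation.EqvGen (fun a b => ∃ e, s e = a ∧ t e = b) v w)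
    (hbip : ¬ ∃ A : Set V, ∀ e, Xor (s e ∈ A) (t e ∈ A)) :
    Module.finrank ℂ ((V → ℂ) ⧸ LinearMap.range (unorBdry s t)) = 0 := by
  rw [finrank_coker_unorBdry, Submodule.finrank_eq_zero, Submodule.eq_bot_iff]
  intro f hf
  rw [mem_ker_transpose_unorIncMatrix] at hf
  by_contra hne
  obtain ⟨v₀, hv₀⟩ := Function.ne_iff.1 hne
  refine hbip ⟨{v | f v = f v₀}, fun e => ?_⟩
  have hneg : f (t e) = -f (s e) := eq_neg_of_add_eq_zero_left (hf e)
  have hsq : f (s e) ^ 2 = f v₀ ^ 2 :=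
    eq_of_eqvGen_edge (g := fun v => f v ^ 2)
      (fun e => by simp only [eq_neg_of_add_eq_zero_left (hf e), neg_sq]) (hconn (s e) v₀)
  have hself : -f v₀ ≠ f v₀ := neg_ne_self.2 hv₀
  rcases sq_eq_sq_iff_eq_or_eq_neg.1 hsq with h | h
  · exact Or.inl ⟨h, by simpa [hneg, h] using hself⟩
  · exact Or.inr ⟨by simp [hneg, h], by simpa [h] using hself⟩

/-- **Betti numbers of a finite connected graph (unoriented homology).**
For a finite connected graph, `dim ker ∂̄ = |E| − |V| + β` and the cokernel of
`∂̄` has dimension `β`, where `β = 1` if the graph is bipartite and `β = 0`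
otherwise. -/
theorem unoriented_boundary_map_rank
    [Fintype V] [Fintype E] [DecidableEq V] [Nonempty V]
    (s t : E → V)
    (hconn : ∀ v w : V, Relation.EqvGen (fun a b => ∃ e, s e = a ∧ t e = b) v w) :
    ((∃ A : Set V, ∀ e, Xor' (s e ∈ A) (t e ∈ A)) →
      (Module.finrank ℂ (LinearMap.ker (unorBdry s t)) : ℤ) =
          (Fintype.card E : ℤ) - Fintype.card V + 1 ∧
        Module.finrank ℂ ((V → ℂ) ⧸ LinearMap.range (unorBdry s t)) = 1) ∧
    (¬ (∃ A : Set V, ∀ e, Xor' (s e ∈ A) (t e ∈ A)) →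
      (Module.finrank ℂ (LinearMap.ker (unorBdry s t)) : ℤ) =
          (Fintype.card E : ℤ) - Fintype.card V ∧
        Module.finrank ℂ ((V → ℂ) ⧸ LinearMap.range (unorBdry s t)) = 0) := by
  refine ⟨fun hbip => ?_, fun hbip => ?_⟩
  · have h := finrank_coker_unorBdry_of_bipartite hconn hbip
    exact ⟨by rw [finrank_ker_unorBdry, h, Nat.cast_one], h⟩
  · have h := finrank_coker_unorBdry_of_not_bipartite hconn hbip
    exact ⟨by rw [finrank_ker_unorBdry, h, Nat.cast_zero, add_zero], h⟩
end

section
/- Let G be a finite connected graph and ∂V ⊆ V a nonempty boundary set. Then the relative unoriented boundary map ∂̄^{rel} : ℂ^E → ℂ^{V∖∂V} satisfies dim ker ∂̄^{rel} = |E| − |V| + |∂V|. -/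
open Finset

variable {V E : Type*}

/-- The relative unoriented boundary of a single edge is the sum of the indicators of its
endpoints, restricted to the complement of the boundary set. -/
lemma relUnorBdry_single [Fintype E] [DecidableEq E] [DecidableEq V] (s t : E → V)
    (bd : Finset V) (e : E) :
    relUnorBdry s t bd (Pi.single e 1) =
      (fun w => (Pi.single (s e) 1 : V → ℂ) w.val) +
        fun w => (Pi.single (t e) 1 : V → ℂ) w.val := by
  funext w
  simp [relUnorBdry, Pi.single_apply, eq_comm, add_comm]

/-- On a connected graph with nonempty boundary set, the relative unoriented boundary map is
surjective. -/
lemma range_relUnorBdry [Fintype V] [Fintype E] [DecidableEq V] (s t : E → V)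
    (hconn : ∀ v w : V, Relation.EqvGen (fun a b => ∃ e, s e = a ∧ t e = b) v w)
    (bd : Finset V) (hbd : bd.Nonempty) :
    LinearMap.range (relUnorBdry s t bd) = ⊤ := by
  classical
  set R := LinearMap.range (relUnorBdry s t bd)
  have mem_iff : ∀ a b : V, Relation.EqvGen (fun a b => ∃ e, s e = a ∧ t e = b) a b →
      ((fun w => (Pi.single a 1 : V → ℂ) w.val) ∈ R ↔
        (fun w => (Pi.single b 1 : V → ℂ) w.val) ∈ R) := by
    intro a b h
    induction h with
    | rel a b h =>
      obtain ⟨e, rfl, rfl⟩ := h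
      have hsum := relUnorBdry_single s t bd e ▸
        LinearMap.mem_range_self (relUnorBdry s t bd) (Pi.single e 1)
      exact ⟨fun h => (R.add_mem_iff_right h).1 hsum, fun h => (R.add_mem_iff_left h).1 hsum⟩
    | refl => rfl
    | symm _ _ _ ih => exact ih.symm
    | trans _ _ _ _ _ ih₁ ih₂ => exact ih₁.trans ih₂
  obtain ⟨b, hb⟩ := hbd
  have hzero : (fun w : {v : V // v ∉ bd} => (Pi.single b 1 : V → ℂ) w.val) = 0 := by
    funext w
    exact Pi.single_eq_of_ne (fun h : w.val = b => w.2 (h ▸ hb)) 1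
  rw [eq_top_iff, ← (Pi.basisFun ℂ {v : V // v ∉ bd}).span_eq, Submodule.span_le]
  rintro _ ⟨v, rfl⟩
  have hv := (mem_iff b v.val (hconn b v)).1 (hzero ▸ R.zero_mem)
  have hbasis : Pi.basisFun ℂ {v : V // v ∉ bd} v =
      fun w => (Pi.single v.val 1 : V → ℂ) w.val := by
    funext w
    simp [Pi.single_apply, Subtype.ext_iff]
  exact hbasis ▸ hv

/-- **Relative Betti numbers of a finite connected graph (unoriented homology).**
For a finite connected graph with nonempty boundary set `∂V`,
`dim ker ∂̄^{rel} = |E| − |V| + |∂V|`. -/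
theorem relative_unoriented_boundary_map_rank
    [Fintype V] [Fintype E] [DecidableEq V] [Nonempty V]
    (s t : E → V)
    (hconn : ∀ v w : V, Relation.EqvGen (fun a b => ∃ e, s e = a ∧ t e = b) v w)
    (bd : Finset V) (hbd : bd.Nonempty) :
    (Module.finrank ℂ (LinearMap.ker (relUnorBdry s t bd)) : ℤ) =
      (Fintype.card E : ℤ) - Fintype.card V + bd.card := by
  have hrank := (relUnorBdry s t bd).finrank_range_add_finrank_ker
  have hcard : Fintype.card {v : V // v ∉ bd} = Fintype.card V - bd.card := by
    rw [Fintype.card_subtype_compl, Fintype.card_coe]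
  have hle : bd.card ≤ Fintype.card V := bd.card_le_univ
  rw [range_relUnorBdry s t hconn bd hbd, finrank_top, Module.finrank_fintype_fun_eq_card,
    Module.finrank_fintype_fun_eq_card, hcard] at hrank
  omega
end

section
/- Let (G,m) be a finite connected weighted graph with normalised weights, and let ∂V ⊆ V be a nonempty boundary set with V∖∂V nonempty. Then every eigenvalue of the Dirichlet Laplacian Δ^{∂V} lies in the open interval (0,2). -/
open Finset

variable {V E : Type*}

theorem sum_sum_fiber_eq [Fintype V] [Fintype E] [DecidableEq V] {M : Type*} [AddCommMonoid M]
    (r : E → V) (f : V → E → M) :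
    ∑ v, ∑ e ∈ univ.filter (fun e => r e = v), f v e = ∑ e, f (r e) e := by
  simp_rw [Finset.sum_filter]
  rw [Finset.sum_comm]
  simp

/-- The weighted square norm of `F` as a sum over edges, when the weights are normalised. -/
theorem sum_weight_mul_normSq [Fintype V] [Fintype E] [DecidableEq V]
    {s t : E → V} {mV : V → ℝ} {mE : E → ℝ}
    (hnorm : ∀ v, (∑ e ∈ univ.filter fun e => s e = v, mE e) +
        (∑ e ∈ univ.filter fun e => t e = v, mE e) = mV v) (F : V → ℂ) :
    ∑ v, mV v * Complex.normSq (F v) =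
      ∑ e, mE e * (Complex.normSq (F (s e)) + Complex.normSq (F (t e))) := by
  simp_rw [← hnorm, add_mul, Finset.sum_mul, Finset.sum_add_distrib, mul_add,
    Finset.sum_add_distrib]
  rw [sum_sum_fiber_eq s fun v e => mE e * Complex.normSq (F v),
    sum_sum_fiber_eq t fun v e => mE e * Complex.normSq (F v)]

/-- The Dirichlet eigenvalue equation at an inner vertex, for normalised weights. -/
theorem dirLap_eigenvector_apply [Fintype E] [DecidableEq V]
    {s t : E → V} {mV : V → ℝ} {mE : E → ℝ} {bd : Finset V} (hmV : ∀ v, 0 < mV v)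
    (hnorm : ∀ v, (∑ e ∈ univ.filter fun e => s e = v, mE e) +
        (∑ e ∈ univ.filter fun e => t e = v, mE e) = mV v)
    {μ : ℂ} {F : dirDom (V := V) bd} (hF : dirLap s t mV mE bd F = μ • F)
    {v : V} (hv : v ∉ bd) :
    (1 - μ) * (mV v * F.1 v) =
      (∑ e ∈ univ.filter fun e => s e = v, (mE e : ℂ) * F.1 (t e)) +
        ∑ e ∈ univ.filter fun e => t e = v, (mE e : ℂ) * F.1 (s e) := by
  have h := congrFun (congrArg Subtype.val hF) v
  have hm : (mV v : ℂ) ≠ 0 := by exact_mod_cast (hmV v).ne'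
  simp only [dirLap, LinearMap.codRestrict_apply, LinearMap.comp_apply, zeroOut, lap,
    LinearMap.coe_mk, AddHom.coe_mk, hv, if_false, lapFun, hnorm, div_self (hmV v).ne',
    Submodule.subtype_apply, Submodule.coe_smul, Pi.smul_apply, smul_eq_mul,
    Complex.ofReal_one, one_mul] at h
  field_simp at h
  linear_combination h

/-- The quadratic form of a Dirichlet eigenvector as a sum over edges. -/
theorem dirLap_eigenvector_form [Fintype V] [Fintype E] [DecidableEq V]
    {s t : E → V} {mV : V → ℝ} {mE : E → ℝ} {bd : Finset V} (hmV : ∀ v, 0 < mV v)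
    (hnorm : ∀ v, (∑ e ∈ univ.filter fun e => s e = v, mE e) +
        (∑ e ∈ univ.filter fun e => t e = v, mE e) = mV v)
    {μ : ℂ} {F : dirDom (V := V) bd} (hF : dirLap s t mV mE bd F = μ • F) :
    (1 - μ) * (∑ v, mV v * Complex.normSq (F.1 v) : ℝ) =
      (∑ e, mE e * (2 * (F.1 (s e) * star (F.1 (t e))).re) : ℝ) := by
  have key : ∀ v, (1 - μ) * (mV v * Complex.normSq (F.1 v)) =
      (∑ e ∈ univ.filter fun e => s e = v, (mE e : ℂ) * F.1 (t e) * star (F.1 v)) +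
        ∑ e ∈ univ.filter fun e => t e = v, (mE e : ℂ) * F.1 (s e) * star (F.1 v) := by
    intro v
    by_cases hv : v ∈ bd
    · simp [F.2 v hv]
    · rw [← Finset.sum_mul, ← Finset.sum_mul, ← add_mul,
        ← dirLap_eigenvector_apply hmV hnorm hF hv, ← Complex.mul_conj, starRingEnd_apply]
      ring
  push_cast
  rw [Finset.mul_sum]
  simp_rw [key]
  rw [Finset.sum_add_distrib,
    sum_sum_fiber_eq s fun v e => (mE e : ℂ) * F.1 (t e) * star (F.1 v),
    sum_sum_fiber_eq t fun v e => (mE e : ℂ) * F.1 (s e) * star (F.1 v),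
    ← Finset.sum_add_distrib]
  refine Finset.sum_congr rfl fun e _ => ?_
  apply Complex.ext <;> simp <;> ring

/-- On a connected graph, a function whose norm agrees at the two ends of every edge and which
has a zero vanishes identically. -/
theorem eq_zero_of_norm_eq_on_edges {s t : E → V}
    (hconn : ∀ v w : V, Relation.EqvGen (fun a b => ∃ e, s e = a ∧ t e = b) v w)
    {F : V → ℂ} (hF : ∀ e, ‖F (s e)‖ = ‖F (t e)‖) {w : V} (hw : F w = 0) : F = 0 := by
  have h : ∀ a b, Relation.EqvGen (fun a b => ∃ e, s e = a ∧ t e = b) a b →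
      ‖F a‖ = ‖F b‖ := by
    intro a b hab
    induction hab with
    | rel a b hab => obtain ⟨e, rfl, rfl⟩ := hab; exact hF e
    | refl => rfl
    | symm _ _ _ ih => exact ih.symm
    | trans _ _ _ _ _ ih₁ ih₂ => exact ih₁.trans ih₂
  funext v
  simpa [hw] using h v w (hconn v w)

/-- A nonnegative edge energy controlling the variation of `‖F‖` is positive, if `F` is nonzero
but has a zero on a connected graph. -/
theorem edge_energy_pos [Fintype E] {s t : E → V} {mE : E → ℝ} (hmE : ∀ e, 0 < mE e)
    (hconn : ∀ v w : V, Relation.EqvGen (fun a b => ∃ e, s e = a ∧ t e = b) v w)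
    {F : V → ℂ} (hF : F ≠ 0) {w : V} (hw : F w = 0) (g : E → ℂ)
    (hg : ∀ e, g e = 0 → ‖F (s e)‖ = ‖F (t e)‖) :
    0 < ∑ e, mE e * Complex.normSq (g e) := by
  have hnn : ∀ e ∈ univ, 0 ≤ mE e * Complex.normSq (g e) := fun e _ =>
    mul_nonneg (hmE e).le (Complex.normSq_nonneg _)
  refine (Finset.sum_nonneg hnn).lt_of_ne' fun h0 => hF ?_
  refine eq_zero_of_norm_eq_on_edges hconn (fun e => hg e ?_) hw
  simpa [(hmE e).ne'] using (Finset.sum_eq_zero_iff_of_nonneg hnn).1 h0 e (mem_univ e)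

/-- **Dirichlet eigenvalues lie in `(0,2)`.**
For a finite connected weighted graph with normalised weights and a nonempty
boundary `∂V` with nonempty complement, every eigenvalue of the discrete
Dirichlet Laplacian is real and lies in the open interval `(0,2)`. -/
theorem dirichlet_eigenvalues_in_open_interval
    [Fintype V] [Fintype E] [DecidableEq V] [Nonempty V]
    (s t : E → V) (mV : V → ℝ) (mE : E → ℝ)
    (hmV : ∀ v, 0 < mV v) (hmE : ∀ e, 0 < mE e)
    (hnorm : ∀ v, (∑ e ∈ univ.filter fun e => s e = v, mE e) +
        (∑ e ∈ univ.filter fun e => t e = v, mE e) = mV v)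
    (hconn : ∀ v w : V, Relation.EqvGen (fun a b => ∃ e, s e = a ∧ t e = b) v w)
    (bd : Finset V) (hbd : bd.Nonempty) (hbd' : ∃ v : V, v ∉ bd)
    (μ : ℂ) (hμ : Module.End.HasEigenvalue (dirLap s t mV mE bd) μ) :
    μ.im = 0 ∧ 0 < μ.re ∧ μ.re < 2 := by
  obtain ⟨F, hF⟩ := hμ.exists_hasEigenvector
  obtain ⟨w, hw⟩ := hbd
  have hw0 : F.1 w = 0 := F.2 w hw
  have hF0 : F.1 ≠ 0 := fun h => hF.2 (Subtype.ext h)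
  have hform := dirLap_eigenvector_form hmV hnorm hF.apply_eq_smul
  have hsum := sum_weight_mul_normSq hnorm F.1
  have hsub := edge_energy_pos hmE hconn hF0 hw0 (fun e => F.1 (s e) - F.1 (t e))
    fun e he => by rw [sub_eq_zero.1 he]
  have hadd := edge_energy_pos hmE hconn hF0 hw0 (fun e => F.1 (s e) + F.1 (t e))
    fun e he => by rw [eq_neg_of_add_eq_zero_left he, norm_neg]
  simp only [Complex.normSq_sub, mul_sub, Finset.sum_sub_distrib] at hsub
  simp only [Complex.normSq_add, mul_add (mE _) (_ + _), Finset.sum_add_distrib] at hadd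
  rw [← hsum] at hsub hadd
  simp_rw [← starRingEnd_apply] at hform
  set N := ∑ v, mV v * Complex.normSq (F.1 v)
  have hre := congrArg Complex.re hform
  have him := congrArg Complex.im hform
  simp only [Complex.re_mul_ofReal, Complex.im_mul_ofReal, Complex.sub_re, Complex.sub_im,
    Complex.one_re, Complex.one_im, Complex.ofReal_re, Complex.ofReal_im] at hre him
  have hN : 0 < N := by linarith
  refine ⟨?_, ?_, ?_⟩
  · simpa [hN.ne'] using him
  · exact pos_of_mul_pos_left (by linarith : 0 < μ.re * N) hN.le
  · exact sub_pos.1 (pos_of_mul_pos_left (by linarith : 0 < (2 - μ.re) * N) hN.le)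
end

section
/- Let G be a Γ-periodic graph with fundamental domain (E_H, V_H, ∂V), let V₀ ⊆ V be a set of representatives of the Γ-orbits of vertices, with N := |V₀| < ∞, and let ρ : Γ → U(r) be a unitary representation of Γ on ℂ^r. The ρ-equivariant space L_ρ := {F : V → ℂ^r | F(γ·v) = ρ(γ)F(v) for all γ ∈ Γ, v ∈ V} has dimension rN, is invariant under the standard Laplacian of G, (Δ_G F)(v) = F(v) − (1/deg_G v)·(∑_{e: s e = v} F(t e) + ∑_{e: t e = v} F(s e)) applied componentwise, and the restriction of Δ_G to L_ρ is self-adjoint for the inner product ⟨F,G⟩ = ∑_{v∈V₀} deg_G(v)·⟨F(v),G(v)⟩_{ℂ^r}. Let μ_1^ρ ≤ … ≤ μ_{rN}^ρ be the eigenvalues of this restriction, listed in increasing order with multiplicity. Then for every k with 1 ≤ k ≤ N and every j with (k−1)r < j ≤ kr one has μ_k ≤ μ_j^ρ ≤ μ_k^{∂V}; i.e. μ_j^ρ lies in the discrete Kirchhoff–Dirichlet interval J_k of the fundamental domain. -/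
open Finset

variable {V E : Type*}

/-- The degree of a vertex in the (possibly infinite) graph `G`:
the number of incidences (a loop counts twice). -/
noncomputable def degG (s t : E → V)
    [∀ v : V, Fintype {e : E // s e = v}] [∀ v : V, Fintype {e : E // t e = v}] (v : V) : ℕ :=
  Fintype.card {e : E // s e = v} + Fintype.card {e : E // t e = v}

/-- The vertex set `V_H = s(E_H) ∪ t(E_H)` of the fundamental domain. -/
noncomputable def VH [DecidableEq V] (s t : E → V) (EH : Finset E) : Finset V :=
  EH.image s ∪ EH.image t

/-- The degree of a vertex in the finite graph `H = (V_H, E_H)`. -/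
noncomputable def degH [DecidableEq V] (s t : E → V) (EH : Finset E) (v : V) : ℕ :=
  (EH.filter fun e => s e = v).card + (EH.filter fun e => t e = v).card

/-- The standard discrete Laplacian of the finite graph `H = (V_H, E_H)`,
`(Δ_H F)(v) = F(v) − (1/deg_H v)·(∑_{e∈E_H : s e = v} F(t e) + ∑_{e∈E_H : t e = v} F(s e))`. -/
noncomputable def lapH [DecidableEq V] [DecidableEq E] (s t : E → V) (EH : Finset E) :
    (↥(VH s t EH) → ℂ) →ₗ[ℂ] (↥(VH s t EH) → ℂ) where
  toFun F := fun w => F w - ((degH s t EH w.val : ℝ) : ℂ)⁻¹ *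
    ((∑ e ∈ EH.attach.filter fun e => s e.val = w.val,
        F ⟨t e.val, Finset.mem_union_right _ (Finset.mem_image_of_mem t e.2)⟩) +
      ∑ e ∈ EH.attach.filter fun e => t e.val = w.val,
        F ⟨s e.val, Finset.mem_union_left _ (Finset.mem_image_of_mem s e.2)⟩)
  map_add' F G := by
    funext w
    simp only [Pi.add_apply, Finset.sum_add_distrib]
    ring
  map_smul' c F := by
    funext w
    simp only [Pi.smul_apply, smul_eq_mul, RingHom.id_apply, ← Finset.mul_sum]
    ring

/-- The subspace of functions on `V_H` vanishing on the boundary `∂V`. -/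
noncomputable def dirDomH [DecidableEq V] (s t : E → V) (EH : Finset E) (bd : Finset V) :
    Submodule ℂ (↥(VH s t EH) → ℂ) where
  carrier := {F | ∀ w : ↥(VH s t EH), w.val ∈ bd → F w = 0}
  add_mem' := fun {F G} hF hG w hw => by simp [hF w hw, hG w hw]
  zero_mem' := fun w _ => rfl
  smul_mem' := fun c F hF w hw => by simp [hF w hw]

/-- Setting the values on the boundary `∂V` to zero. -/
noncomputable def zeroOutH [DecidableEq V] (s t : E → V) (EH : Finset E) (bd : Finset V) :
    (↥(VH s t EH) → ℂ) →ₗ[ℂ] (↥(VH s t EH) → ℂ) where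
  toFun F := fun w => if w.val ∈ bd then 0 else F w
  map_add' F G := by funext w; by_cases h : w.val ∈ bd <;> simp [h]
  map_smul' c F := by funext w; by_cases h : w.val ∈ bd <;> simp [h]

/-- The Dirichlet Laplacian `Δ_H^{∂V}` of the fundamental domain, i.e. the
compression of `Δ_H` to the functions vanishing on `∂V`. -/
noncomputable def dirLapH [DecidableEq V] [DecidableEq E] (s t : E → V) (EH : Finset E)
    (bd : Finset V) : dirDomH s t EH bd →ₗ[ℂ] dirDomH s t EH bd :=
  LinearMap.codRestrict (dirDomH s t EH bd)
    ((zeroOutH s t EH bd).comp ((lapH s t EH).comp (dirDomH s t EH bd).subtype))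
    (fun F => by intro w hw; simp [zeroOutH, hw])

/-- The standard (vector-valued) Laplacian of `G` acting componentwise on
functions `F : V → ℂ^r`:
`(Δ_G F)(v) = F(v) − (1/deg_G v)·(∑_{e : s e = v} F(t e) + ∑_{e : t e = v} F(s e))`. -/
noncomputable def lapGVec (s t : E → V)
    [∀ v : V, Fintype {e : E // s e = v}] [∀ v : V, Fintype {e : E // t e = v}] (r : ℕ) :
    (V → Fin r → ℂ) →ₗ[ℂ] (V → Fin r → ℂ) where
  toFun F := fun v => F v - (((degG s t v : ℝ) : ℂ))⁻¹ •
    ((∑ e : {e : E // s e = v}, F (t e.val)) + ∑ e : {e : E // t e = v}, F (s e.val))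
  map_add' F G := by
    funext v
    simp only [Pi.add_apply, Finset.sum_add_distrib]
    module
  map_smul' c F := by
    funext v
    simp only [Pi.smul_apply, RingHom.id_apply, ← Finset.smul_sum]
    module

/-- The space `L_ρ` of `ρ`-equivariant functions `F : V → ℂ^r`,
`F(γ·v) = ρ(γ) F(v)`. -/
noncomputable def equivariantSpace {Γ : Type*} [Group Γ] [MulAction Γ V] (r : ℕ)
    (ρ : Γ →* Matrix.unitaryGroup (Fin r) ℂ) : Submodule ℂ (V → Fin r → ℂ) where
  carrier := {F | ∀ (γ : Γ) (v : V),
    F (γ • v) = Matrix.mulVec (ρ γ : Matrix (Fin r) (Fin r) ℂ) (F v)}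
  add_mem' := fun {F G} hF hG γ v => by
    simp [Pi.add_apply, hF γ v, hG γ v, Matrix.mulVec_add]
  zero_mem' := fun γ v => by simp
  smul_mem' := fun c F hF γ v => by
    simp [Pi.smul_apply, hF γ v, Matrix.mulVec_smul]

/-- Two real families on finite types whose values have the same multiplicities agree up to a
bijection of the index types. -/
lemma exists_equiv_of_card_fiber_eq {ι κ : Type*} [Fintype ι] [Fintype κ] (f : ι → ℝ)
    (g : κ → ℝ)
    (h : ∀ x : ℝ, (univ.filter fun i => f i = x).card = (univ.filter fun j => g j = x).card) :
    ∃ σ : ι ≃ κ, ∀ i, g (σ i) = f i := by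
  classical
  have hcard : ∀ x : ℝ, Fintype.card {i // f i = x} = Fintype.card {j // g j = x} := by
    intro x
    rw [Fintype.card_subtype, Fintype.card_subtype, h x]
  let τ : ∀ x : ℝ, {i // f i = x} ≃ {j // g j = x} := fun x => Fintype.equivOfCardEq (hcard x)
  refine ⟨(Equiv.sigmaFiberEquiv f).symm.trans
    ((Equiv.sigmaCongrRight τ).trans (Equiv.sigmaFiberEquiv g)), fun i => ?_⟩
  exact (τ (f i) ⟨i, rfl⟩).2

/-- A symmetric operator is diagonal in an orthonormal basis indexed by any listing of its
eigenvalues with multiplicity. -/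
lemma LinearMap.IsSymmetric.exists_orthonormalBasis_of_card_eq {X ι : Type*} [Fintype ι]
    [NormedAddCommGroup X] [InnerProductSpace ℂ X] [FiniteDimensional ℂ X] {T : X →ₗ[ℂ] X}
    (hT : T.IsSymmetric) (μ : ι → ℝ)
    (hcount : ∀ x : ℝ, (univ.filter fun i => μ i = x).card =
      Module.finrank ℂ (LinearMap.ker (T - (x : ℂ) • (LinearMap.id : X →ₗ[ℂ] X)))) :
    ∃ b : OrthonormalBasis ι ℂ X, ∀ i, T (b i) = (μ i : ℂ) • b i := by
  have key : ∀ x : ℝ, (univ.filter fun i => hT.eigenvalues rfl i = x).card =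
      (univ.filter fun i => μ i = x).card := by
    intro x
    rw [hcount x]
    have h := hT.card_filter_eigenvalues_eq rfl (x : ℂ)
    rw [Module.End.eigenspace_def] at h
    have h2 : (univ.filter fun i => hT.eigenvalues rfl i = x) =
        univ.filter fun i => ((hT.eigenvalues rfl i : ℝ) : ℂ) = (x : ℂ) := by
      ext i
      simp
    rw [h2]
    exact h
  obtain ⟨σ, hσ⟩ := exists_equiv_of_card_fiber_eq _ _ key
  refine ⟨(hT.eigenvectorBasis rfl).reindex σ, fun i => ?_⟩
  rw [OrthonormalBasis.reindex_apply, hT.apply_eigenvectorBasis]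
  have := hσ (σ.symm i)
  rw [Equiv.apply_symm_apply] at this
  rw [this]
  rfl

lemma star_dotProduct_self_eq_sum_norm_sq {α : Type*} [Fintype α] (f : α → ℂ) :
    star f ⬝ᵥ f = ((∑ i, ‖f i‖ ^ 2 : ℝ) : ℂ) := by
  simp [dotProduct, Complex.conj_mul']

/-- Diagonalization of a quadratic form `‖d F‖²` relative to `‖a F‖²`, where `T` is the operator
representing the former with respect to the latter. -/
lemma exists_diagonalizing_coordinates {W ι α β : Type*} [Fintype ι] [Fintype α] [Fintype β]
    [AddCommGroup W] [Module ℂ W] (a : W →ₗ[ℂ] (α → ℂ)) (ha : Function.Injective a)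
    (d : W →ₗ[ℂ] (β → ℂ)) (T : W →ₗ[ℂ] W)
    (hT : ∀ F G, star (a (T F)) ⬝ᵥ a G = star (d F) ⬝ᵥ d G) (μ : ι → ℝ)
    (hcount : ∀ x : ℝ, (univ.filter fun i => μ i = x).card =
      Module.finrank ℂ (LinearMap.ker (T - (x : ℂ) • (LinearMap.id : W →ₗ[ℂ] W)))) :
    ∃ Q : W ≃ₗ[ℂ] (ι → ℂ), ∀ F, ∑ i, ‖a F i‖ ^ 2 = ∑ i, ‖Q F i‖ ^ 2 ∧
      ∑ j, ‖d F j‖ ^ 2 = ∑ i, μ i * ‖Q F i‖ ^ 2 := by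
  classical
  let A : W →ₗ[ℂ] EuclideanSpace ℂ α := (WithLp.linearEquiv 2 ℂ (α → ℂ)).symm.toLinearMap ∘ₗ a
  have hA : Function.Injective A := (WithLp.linearEquiv 2 ℂ (α → ℂ)).symm.injective.comp ha
  let e : W ≃ₗ[ℂ] LinearMap.range A := LinearEquiv.ofInjective A hA
  have he : ∀ F G, inner ℂ (e F) (e G) = star (a F) ⬝ᵥ a G := by
    intro F G
    simp [Submodule.coe_inner, e, A, EuclideanSpace.inner_eq_star_dotProduct, dotProduct_comm]
  let S : LinearMap.range A →ₗ[ℂ] LinearMap.range A := e.conj T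
  have heS : ∀ F, S (e F) = e (T F) := by
    intro F
    simp [S, LinearEquiv.conj_apply]
  have hTd : ∀ F G, star (a F) ⬝ᵥ a (T G) = star (d F) ⬝ᵥ d G := by
    intro F G
    rw [Matrix.star_dotProduct, hT G F, ← Matrix.star_dotProduct]
  have hS : LinearMap.IsSymmetric (𝕜 := ℂ) (E := LinearMap.range A) S := by
    intro x y
    obtain ⟨F, rfl⟩ := e.surjective x
    obtain ⟨G, rfl⟩ := e.surjective y
    rw [heS, heS, he, he, hT, hTd]
  have hker : ∀ x : ℝ, Module.finrank ℂ (LinearMap.ker (T - (x : ℂ) • LinearMap.id)) =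
      Module.finrank ℂ (LinearMap.ker (S - (x : ℂ) • LinearMap.id)) := by
    intro x
    have : LinearMap.ker (S - (x : ℂ) • LinearMap.id) =
        (LinearMap.ker (T - (x : ℂ) • LinearMap.id)).map e.toLinearMap := by
      ext y
      obtain ⟨F, rfl⟩ := e.surjective y
      rw [Submodule.mem_map_equiv]
      simp only [LinearMap.mem_ker, LinearMap.sub_apply, LinearMap.smul_apply, LinearMap.id_apply,
        heS, LinearEquiv.symm_apply_apply, ← map_smul, ← map_sub, LinearEquiv.map_eq_zero_iff]
    rw [this]
    exact (e.submoduleMap _).finrank_eq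
  obtain ⟨b, hb⟩ := hS.exists_orthonormalBasis_of_card_eq μ fun x => (hcount x).trans (hker x)
  have hrepr : ∀ y i, b.repr (S y) i = (μ i : ℂ) * b.repr y i := by
    intro y i
    rw [b.repr_apply_apply, b.repr_apply_apply, ← hS, hb, inner_smul_left, Complex.conj_ofReal]
  refine ⟨e.trans (b.repr.toLinearEquiv.trans (WithLp.linearEquiv 2 ℂ (ι → ℂ))), fun F => ?_⟩
  constructor
  · have h1 := he F F
    rw [star_dotProduct_self_eq_sum_norm_sq, ← b.repr.inner_map_map, PiLp.inner_apply] at h1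
    apply Complex.ofReal_injective
    rw [← h1]
    push_cast
    refine Finset.sum_congr rfl fun i _ => ?_
    simp
  · have h1 := he F (T F)
    rw [hTd, star_dotProduct_self_eq_sum_norm_sq, ← heS, ← b.repr.inner_map_map,
      PiLp.inner_apply] at h1
    simp only [hrepr] at h1
    apply Complex.ofReal_injective
    rw [← h1]
    push_cast
    refine Finset.sum_congr rfl fun i _ => ?_
    simp [mul_assoc, Complex.mul_conj']

/-- Comparison of diagonal quadratic forms: if a linear map preserves the sums of squares and
the two diagonal forms, then having many small values `lam` in the domain compared to the small
values `ν` in the codomain is contradictory. -/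
lemma le_of_card_lt_card_of_diagonal {ι κ : Type*} [Fintype ι] [Fintype κ]
    (J : (ι → ℂ) →ₗ[ℂ] (κ → ℂ)) (lam : ι → ℝ) (ν : κ → ℝ)
    (hI : ∀ c, ∑ l, ‖J c l‖ ^ 2 = ∑ i, ‖c i‖ ^ 2)
    (hq : ∀ c, ∑ l, ν l * ‖J c l‖ ^ 2 = ∑ i, lam i * ‖c i‖ ^ 2) (x y : ℝ)
    (hcard : (univ.filter fun l => ν l < y).card < (univ.filter fun i => lam i ≤ x).card) :
    y ≤ x := by
  classical
  by_contra! hxy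
  let P : ({i // lam i ≤ x} → ℂ) →ₗ[ℂ] (ι → ℂ) := Function.ExtendByZero.linearMap ℂ Subtype.val
  let R : (κ → ℂ) →ₗ[ℂ] ({l // ν l < y} → ℂ) := LinearMap.funLeft ℂ ℂ Subtype.val
  have hne : LinearMap.ker (R ∘ₗ J ∘ₗ P) ≠ ⊥ := by
    apply LinearMap.ker_ne_bot_of_finrank_lt
    simpa [Fintype.card_subtype] using hcard
  obtain ⟨c, hc, hc0⟩ := Submodule.exists_mem_ne_zero_of_ne_bot hne
  have hPlow : ∀ i, ¬ lam i ≤ x → P c i = 0 := by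
    intro i hi
    refine Function.extend_apply' _ _ _ ?_
    rintro ⟨a, rfl⟩
    exact hi a.2
  have hPc : ∀ i, P c i.1 = c i := fun i => Subtype.val_injective.extend_apply c 0 i
  have hJ : ∀ l, ν l < y → J (P c) l = 0 := fun l hl => congrFun hc ⟨l, hl⟩
  have h1 : ∑ i, lam i * ‖P c i‖ ^ 2 ≤ x * ∑ i, ‖P c i‖ ^ 2 := by
    rw [Finset.mul_sum]
    refine Finset.sum_le_sum fun i _ => ?_
    by_cases hi : lam i ≤ x
    · gcongr
    · simp [hPlow i hi]
  have h2 : y * ∑ l, ‖J (P c) l‖ ^ 2 ≤ ∑ l, ν l * ‖J (P c) l‖ ^ 2 := by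
    rw [Finset.mul_sum]
    refine Finset.sum_le_sum fun l _ => ?_
    by_cases hl : ν l < y
    · simp [hJ l hl]
    · gcongr
      exact not_lt.1 hl
  have hpos : 0 < ∑ i, ‖P c i‖ ^ 2 := by
    obtain ⟨i, hi⟩ := Function.ne_iff.1 hc0
    refine Finset.sum_pos' (fun _ _ => by positivity) ⟨i.1, mem_univ _, ?_⟩
    rw [hPc]
    have : 0 < ‖c i‖ := norm_pos_iff.2 hi
    positivity
  rw [hI, hq] at h2
  nlinarith

lemma card_filter_lt_le_of_monotone {n : ℕ} {f : Fin n → ℝ} (hf : Monotone f) (j : Fin n) :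
    (univ.filter fun l => f l < f j).card ≤ (j : ℕ) := by
  rw [← Fin.card_Iio j]
  refine Finset.card_le_card fun l hl => ?_
  rw [Finset.mem_Iio]
  exact hf.reflect_lt (by simpa using hl)

lemma lt_card_filter_le_of_monotone {n : ℕ} {f : Fin n → ℝ} (hf : Monotone f) (j : Fin n) :
    (j : ℕ) < (univ.filter fun l => f l ≤ f j).card := by
  have : (Finset.Iic j).card ≤ (univ.filter fun l => f l ≤ f j).card := by
    refine Finset.card_le_card fun l hl => ?_
    simpa using hf (Finset.mem_Iic.1 hl)
  rw [Fin.card_Iic] at this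
  omega

lemma card_filter_snd {α β : Type*} [Fintype α] [Fintype β] (p : β → Prop) [DecidablePred p] :
    (univ.filter fun x : α × β => p x.2).card = Fintype.card α * (univ.filter p).card := by
  rw [← Finset.card_univ, ← Finset.card_product]
  congr 1
  ext x
  simp

/-- The `r`-fold direct sum of a linear map into a coordinate space. -/
noncomputable def componentwise {X α : Type*} [AddCommGroup X] [Module ℂ X] (r : ℕ)
    (A : X →ₗ[ℂ] (α → ℂ)) : (Fin r → X) →ₗ[ℂ] (Fin r × α → ℂ) :=
  LinearMap.pi fun p => LinearMap.proj p.2 ∘ₗ A ∘ₗ LinearMap.proj p.1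

/-- The `r`-fold direct sum of a linear equivalence with a coordinate space. -/
noncomputable def componentwiseEquiv {X α : Type*} [AddCommGroup X] [Module ℂ X] (r : ℕ)
    (Q : X ≃ₗ[ℂ] (α → ℂ)) : (Fin r → X) ≃ₗ[ℂ] (Fin r × α → ℂ) :=
  (LinearEquiv.piCongrRight fun _ : Fin r => Q).trans (LinearEquiv.curry ℂ ℂ (Fin r) α).symm

/-- A vector-valued function viewed as the family of its components. -/
def components (U : Type*) (r : ℕ) : (U → Fin r → ℂ) →ₗ[ℂ] (Fin r → U → ℂ) where
  toFun F i u := F u i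
  map_add' _ _ := rfl
  map_smul' _ _ := rfl

/-- The values of a function at the initial and terminal vertices of the edges. -/
def endpointValues {U ι : Type*} (σ τ : ι → U) : (U → ℂ) →ₗ[ℂ] (ι ⊕ ι → ℂ) :=
  LinearMap.funLeft ℂ ℂ (Sum.elim σ τ)

/-- The differences of a function along the edges. -/
def edgeDifference {U ι : Type*} (σ τ : ι → U) : (U → ℂ) →ₗ[ℂ] (ι → ℂ) :=
  LinearMap.funLeft ℂ ℂ τ - LinearMap.funLeft ℂ ℂ σ

lemma sum_norm_sq_edgeDifference_le {U ι : Type*} [Fintype ι] (σ τ : ι → U) (F : U → ℂ) :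
    ∑ e, ‖edgeDifference σ τ F e‖ ^ 2 ≤ 2 * ∑ x, ‖endpointValues σ τ F x‖ ^ 2 := by
  rw [Fintype.sum_sum_type, ← Finset.sum_add_distrib, Finset.mul_sum]
  refine Finset.sum_le_sum fun e _ => ?_
  have h := norm_sub_le (F (τ e)) (F (σ e))
  have h0 := norm_nonneg (F (τ e) - F (σ e))
  change ‖F (τ e) - F (σ e)‖ ^ 2 ≤ 2 * (‖F (σ e)‖ ^ 2 + ‖F (τ e)‖ ^ 2)
  nlinarith [sq_nonneg (‖F (τ e)‖ - ‖F (σ e)‖)]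

section FundamentalDomain

variable [DecidableEq V] (s t : E → V) (EH : Finset E)

/-- The initial vertex map of the finite graph `H`. -/
def sourceH (e : ↥EH) : ↥(VH s t EH) :=
  ⟨s e.val, Finset.mem_union_left _ (Finset.mem_image_of_mem s e.2)⟩

/-- The terminal vertex map of the finite graph `H`. -/
def targetH (e : ↥EH) : ↥(VH s t EH) :=
  ⟨t e.val, Finset.mem_union_right _ (Finset.mem_image_of_mem t e.2)⟩

lemma exists_endpoint_eq (w : ↥(VH s t EH)) :
    ∃ x : ↥EH ⊕ ↥EH, Sum.elim (sourceH s t EH) (targetH s t EH) x = w := by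
  obtain ⟨w, hw⟩ := w
  rcases Finset.mem_union.1 hw with h | h
  · obtain ⟨e, he, rfl⟩ := Finset.mem_image.1 h
    exact ⟨Sum.inl ⟨e, he⟩, rfl⟩
  · obtain ⟨e, he, rfl⟩ := Finset.mem_image.1 h
    exact ⟨Sum.inr ⟨e, he⟩, rfl⟩

lemma endpointValues_injective :
    Function.Injective (endpointValues (sourceH s t EH) (targetH s t EH)) := by
  intro F G h
  funext w
  obtain ⟨x, rfl⟩ := exists_endpoint_eq s t EH w
  exact congrFun h x

lemma card_filter_attach_eq {σ : E → V} (v : V) :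
    (EH.attach.filter fun e => σ e.val = v).card = (EH.filter fun e => σ e = v).card := by
  rw [← Finset.card_map (Function.Embedding.subtype _)]
  congr 1
  ext e
  simp [and_comm]

lemma degH_ne_zero (w : ↥(VH s t EH)) : degH s t EH w.val ≠ 0 := by
  obtain ⟨w, hw⟩ := w
  rcases Finset.mem_union.1 hw with h | h
  · obtain ⟨e, he, rfl⟩ := Finset.mem_image.1 h
    have : 0 < (EH.filter fun e' => s e' = s e).card := Finset.card_pos.2 ⟨e, by simp [he]⟩
    simp only [degH]
    omega
  · obtain ⟨e, he, rfl⟩ := Finset.mem_image.1 h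
    have : 0 < (EH.filter fun e' => t e' = t e).card := Finset.card_pos.2 ⟨e, by simp [he]⟩
    simp only [degH]
    omega

/-- Discrete Green formula on the finite graph `H`. -/
lemma star_endpointValues_lapH_dotProduct [DecidableEq E] (F G : ↥(VH s t EH) → ℂ) :
    star (endpointValues (sourceH s t EH) (targetH s t EH) (lapH s t EH F)) ⬝ᵥ
        endpointValues (sourceH s t EH) (targetH s t EH) G =
      star (edgeDifference (sourceH s t EH) (targetH s t EH) F) ⬝ᵥ
        edgeDifference (sourceH s t EH) (targetH s t EH) G := by
  set σ := sourceH s t EH with hσ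
  set τ := targetH s t EH with hτ
  set L := lapH s t EH F with hL
  have vertex : ∀ w : ↥(VH s t EH),
      (∑ e with σ e = w, star (L (σ e)) * G (σ e)) + (∑ e with τ e = w, star (L (τ e)) * G (τ e)) =
        (∑ e with σ e = w, star (F (σ e) - F (τ e)) * G (σ e)) +
          ∑ e with τ e = w, star (F (τ e) - F (σ e)) * G (τ e) := by
    intro w
    have hs : (univ.filter fun e => σ e = w) = EH.attach.filter fun e => s e.val = w.val := by
      ext e
      simp [hσ, sourceH, Subtype.ext_iff]
    have ht : (univ.filter fun e => τ e = w) = EH.attach.filter fun e => t e.val = w.val := by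
      ext e
      simp [hτ, targetH, Subtype.ext_iff]
    have hd : ((degH s t EH w.val : ℝ) : ℂ) =
        ((univ.filter fun e => σ e = w).card : ℂ) + ((univ.filter fun e => τ e = w).card : ℂ) := by
      rw [hs, ht, card_filter_attach_eq, card_filter_attach_eq, degH]
      push_cast
      rfl
    have hLw : ((degH s t EH w.val : ℝ) : ℂ) * L w = ((degH s t EH w.val : ℝ) : ℂ) * F w -
        ((∑ e with σ e = w, F (τ e)) + ∑ e with τ e = w, F (σ e)) := by
      have h0 : ((degH s t EH w.val : ℝ) : ℂ) ≠ 0 := by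
        exact_mod_cast degH_ne_zero s t EH w
      have : L w = F w - ((degH s t EH w.val : ℝ) : ℂ)⁻¹ *
          ((∑ e with σ e = w, F (τ e)) + ∑ e with τ e = w, F (σ e)) := by
        rw [hs, ht]
        rfl
      rw [this, mul_sub, mul_inv_cancel_left₀ h0]
    rw [hd] at hLw
    have h1 := congrArg (fun z => star z * G w) hLw
    have e1 : ∀ f : ↥(VH s t EH) → ℂ, ∑ e with σ e = w, star (f (σ e)) * G (σ e) =
        ((univ.filter fun e => σ e = w).card : ℂ) * (star (f w) * G w) := by
      intro f
      rw [← nsmul_eq_mul, ← Finset.sum_const]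
      refine Finset.sum_congr rfl fun e he => ?_
      rw [(Finset.mem_filter.1 he).2]
    have e2 : ∀ f : ↥(VH s t EH) → ℂ, ∑ e with τ e = w, star (f (τ e)) * G (τ e) =
        ((univ.filter fun e => τ e = w).card : ℂ) * (star (f w) * G w) := by
      intro f
      rw [← nsmul_eq_mul, ← Finset.sum_const]
      refine Finset.sum_congr rfl fun e he => ?_
      rw [(Finset.mem_filter.1 he).2]
    have e3 : ∑ e with σ e = w, star (F (τ e)) * G (σ e) =
        star (∑ e with σ e = w, F (τ e)) * G w := by
      rw [star_sum, Finset.sum_mul]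
      refine Finset.sum_congr rfl fun e he => ?_
      rw [(Finset.mem_filter.1 he).2]
    have e4 : ∑ e with τ e = w, star (F (σ e)) * G (τ e) =
        star (∑ e with τ e = w, F (σ e)) * G w := by
      rw [star_sum, Finset.sum_mul]
      refine Finset.sum_congr rfl fun e he => ?_
      rw [(Finset.mem_filter.1 he).2]
    simp only [star_sub, sub_mul, Finset.sum_sub_distrib]
    rw [e1, e2, e1, e2, e3, e4]
    simp only [star_mul', star_add, star_sub, star_natCast] at h1
    linear_combination h1
  have total := Finset.sum_congr (rfl : (univ : Finset ↥(VH s t EH)) = univ)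
    fun w _ => vertex w
  simp only [Finset.sum_add_distrib, Finset.sum_fiberwise] at total
  simp only [dotProduct, Fintype.sum_sum_type, Pi.star_apply]
  refine total.trans ?_
  rw [← Finset.sum_add_distrib]
  refine Finset.sum_congr rfl fun e _ => ?_
  change _ = star (F (τ e) - F (σ e)) * (G (τ e) - G (σ e))
  simp only [star_sub]
  ring

/-- Discrete Green formula for the Dirichlet Laplacian. -/
lemma star_endpointValues_dirLapH_dotProduct [DecidableEq E] (bd : Finset V)
    (F G : dirDomH s t EH bd) :
    star (endpointValues (sourceH s t EH) (targetH s t EH) (dirLapH s t EH bd F).val) ⬝ᵥ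
        endpointValues (sourceH s t EH) (targetH s t EH) G.val =
      star (edgeDifference (sourceH s t EH) (targetH s t EH) F.val) ⬝ᵥ
        edgeDifference (sourceH s t EH) (targetH s t EH) G.val := by
  rw [← star_endpointValues_lapH_dotProduct]
  refine Finset.sum_congr rfl fun x _ => ?_
  obtain ⟨w, hw⟩ : ∃ w, Sum.elim (sourceH s t EH) (targetH s t EH) x = w := ⟨_, rfl⟩
  change star ((dirLapH s t EH bd F).val (Sum.elim _ _ x)) * G.val (Sum.elim _ _ x) =
    star (lapH s t EH F.val (Sum.elim _ _ x)) * G.val (Sum.elim _ _ x)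
  rw [hw]
  by_cases h : w.val ∈ bd
  · rw [G.2 w h, mul_zero, mul_zero]
  · have : (dirLapH s t EH bd F).val w = lapH s t EH F.val w := if_neg h
    rw [this]

end FundamentalDomain

section Equivariant

variable {Γ : Type*} [Group Γ] [MulAction Γ V] {r : ℕ}

lemma star_unitary_mulVec_dotProduct (U : Matrix.unitaryGroup (Fin r) ℂ) (x y : Fin r → ℂ) :
    star ((U : Matrix (Fin r) (Fin r) ℂ).mulVec x) ⬝ᵥ
      (U : Matrix (Fin r) (Fin r) ℂ).mulVec y = star x ⬝ᵥ y := by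
  rw [Matrix.star_mulVec, ← Matrix.dotProduct_mulVec, Matrix.mulVec_mulVec,
    ← Matrix.star_eq_conjTranspose, Matrix.UnitaryGroup.star_mul_self, Matrix.one_mulVec]

lemma star_dotProduct_smul_of_mem {ρ : Γ →* Matrix.unitaryGroup (Fin r) ℂ}
    {F G : V → Fin r → ℂ} (hF : F ∈ equivariantSpace r ρ) (hG : G ∈ equivariantSpace r ρ)
    (γ : Γ) (v w : V) : star (F (γ • v)) ⬝ᵥ G (γ • w) = star (F v) ⬝ᵥ G w := by
  rw [hF γ v, hG γ w, star_unitary_mulVec_dotProduct]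

open Classical in
/-- The equivariant function with prescribed values on `S`, vanishing off the translates
of `S`. -/
noncomputable def equivariantExtension (ρ : Γ →* Matrix.unitaryGroup (Fin r) ℂ) (S : Set V) :
    (V → Fin r → ℂ) →ₗ[ℂ] (V → Fin r → ℂ) where
  toFun F v := if h : ∃ p : Γ × V, p.2 ∈ S ∧ p.1 • p.2 = v then
    (ρ h.choose.1 : Matrix (Fin r) (Fin r) ℂ).mulVec (F h.choose.2) else 0
  map_add' F G := by
    funext v
    by_cases h : ∃ p : Γ × V, p.2 ∈ S ∧ p.1 • p.2 = v
    · simp only [dif_pos h, Pi.add_apply, Matrix.mulVec_add]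
    · simp only [dif_neg h, Pi.add_apply, add_zero]
  map_smul' c F := by
    funext v
    by_cases h : ∃ p : Γ × V, p.2 ∈ S ∧ p.1 • p.2 = v
    · simp only [dif_pos h, Pi.smul_apply, Matrix.mulVec_smul, RingHom.id_apply]
    · simp only [dif_neg h, Pi.smul_apply, smul_zero]

lemma equivariantExtension_of_notMem (ρ : Γ →* Matrix.unitaryGroup (Fin r) ℂ) {S : Set V}
    (F : V → Fin r → ℂ) {v : V} (h : ∀ γ : Γ, ∀ w ∈ S, γ • w ≠ v) :
    equivariantExtension ρ S F v = 0 := by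
  refine dif_neg ?_
  rintro ⟨p, hp, hpv⟩
  exact h p.1 p.2 hp hpv

lemma equivariantExtension_smul (ρ : Γ →* Matrix.unitaryGroup (Fin r) ℂ) {S : Set V}
    (hS : ∀ γ₁ γ₂ : Γ, ∀ v₁ ∈ S, ∀ v₂ ∈ S, γ₁ • v₁ = γ₂ • v₂ → γ₁ = γ₂)
    (F : V → Fin r → ℂ) (γ : Γ) {w : V} (hw : w ∈ S) :
    equivariantExtension ρ S F (γ • w) = (ρ γ : Matrix (Fin r) (Fin r) ℂ).mulVec (F w) := by
  have h : ∃ p : Γ × V, p.2 ∈ S ∧ p.1 • p.2 = γ • w := ⟨(γ, w), hw, rfl⟩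
  have h1 : h.choose.1 = γ := hS _ _ _ h.choose_spec.1 _ hw h.choose_spec.2
  have h2 : h.choose.2 = w := by
    have := h.choose_spec.2
    rw [h1] at this
    exact MulAction.injective γ this
  refine (dif_pos h).trans ?_
  rw [h1, h2]

lemma equivariantExtension_apply (ρ : Γ →* Matrix.unitaryGroup (Fin r) ℂ) {S : Set V}
    (hS : ∀ γ₁ γ₂ : Γ, ∀ v₁ ∈ S, ∀ v₂ ∈ S, γ₁ • v₁ = γ₂ • v₂ → γ₁ = γ₂)
    (F : V → Fin r → ℂ) {w : V} (hw : w ∈ S) : equivariantExtension ρ S F w = F w := by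
  simpa using equivariantExtension_smul ρ hS F 1 hw

lemma equivariantExtension_mem (ρ : Γ →* Matrix.unitaryGroup (Fin r) ℂ) {S : Set V}
    (hS : ∀ γ₁ γ₂ : Γ, ∀ v₁ ∈ S, ∀ v₂ ∈ S, γ₁ • v₁ = γ₂ • v₂ → γ₁ = γ₂)
    (F : V → Fin r → ℂ) : equivariantExtension ρ S F ∈ equivariantSpace r ρ := by
  intro γ v
  by_cases h : ∃ δ : Γ, ∃ w ∈ S, δ • w = v
  · obtain ⟨δ, w, hw, rfl⟩ := h
    rw [smul_smul, equivariantExtension_smul ρ hS F _ hw, equivariantExtension_smul ρ hS F _ hw,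
      Matrix.mulVec_mulVec, map_mul]
    rfl
  · push Not at h
    rw [equivariantExtension_of_notMem ρ F h, equivariantExtension_of_notMem ρ F, Matrix.mulVec_zero]
    intro δ w hw hδ
    refine h (γ⁻¹ * δ) w hw ?_
    rw [mul_smul, hδ, inv_smul_smul]

/-- An equivariant function is determined by arbitrary values on orbit representatives. -/
lemma finrank_equivariantSpace (ρ : Γ →* Matrix.unitaryGroup (Fin r) ℂ)
    (hfreeV : ∀ (γ : Γ) (v : V), γ • v = v → γ = 1) (V₀ : Finset V)
    (hrep : ∀ v : V, ∃ γ : Γ, ∃ w ∈ V₀, γ • w = v)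
    (hrep' : ∀ w₁ ∈ V₀, ∀ w₂ ∈ V₀, (∃ γ : Γ, γ • w₁ = w₂) → w₁ = w₂) :
    Module.finrank ℂ (equivariantSpace (V := V) r ρ) = r * V₀.card := by
  have hS : ∀ γ₁ γ₂ : Γ, ∀ v₁ ∈ (V₀ : Set V), ∀ v₂ ∈ (V₀ : Set V),
      γ₁ • v₁ = γ₂ • v₂ → γ₁ = γ₂ := by
    intro γ₁ γ₂ v₁ h₁ v₂ h₂ h
    have h' : (γ₂⁻¹ * γ₁) • v₁ = v₂ := by rw [mul_smul, h, inv_smul_smul]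
    obtain rfl := hrep' v₁ h₁ v₂ h₂ ⟨_, h'⟩
    exact (inv_mul_eq_one.1 (hfreeV _ _ h')).symm
  let R : equivariantSpace (V := V) r ρ →ₗ[ℂ] (↥V₀ → Fin r → ℂ) :=
    LinearMap.funLeft ℂ (Fin r → ℂ) (Subtype.val : ↥V₀ → V) ∘ₗ (equivariantSpace r ρ).subtype
  have hR : Function.Bijective R := by
    constructor
    · intro F G h
      apply Subtype.ext
      funext v
      obtain ⟨γ, w, hw, rfl⟩ := hrep v
      have hFG : F.val w = G.val w := congrFun h ⟨w, hw⟩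
      rw [F.2 γ w, G.2 γ w, hFG]
    · intro f
      classical
      let F : V → Fin r → ℂ := fun v => if h : v ∈ V₀ then f ⟨v, h⟩ else 0
      refine ⟨⟨equivariantExtension ρ V₀ F, equivariantExtension_mem ρ hS F⟩, ?_⟩
      funext w
      exact (equivariantExtension_apply ρ hS F w.2).trans (dif_pos w.2)
  rw [(LinearEquiv.ofBijective R hR).finrank_eq, Module.finrank_pi_fintype]
  simp [mul_comm]

variable [MulAction Γ E]

/-- Translation identifies the edges at `v` with the edges at `γ • v`. -/
def incidenceEquiv (σ : E → V) (hσ : ∀ (γ : Γ) (e : E), σ (γ • e) = γ • σ e) (γ : Γ) (v : V) :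
    {e : E // σ e = v} ≃ {e : E // σ e = γ • v} :=
  (MulAction.toPerm γ).subtypeEquiv fun e => by simp [hσ]

/-- Summation of an invariant function over the edges at orbit representatives of vertices is
summation over orbit representatives of edges. -/
lemma sum_sum_incident_eq_sum (σ : E → V) (hσ : ∀ (γ : Γ) (e : E), σ (γ • e) = γ • σ e)
    [∀ v : V, Fintype {e : E // σ e = v}]
    (hfreeV : ∀ (γ : Γ) (v : V), γ • v = v → γ = 1) (EH : Finset E)
    (hEH : ∀ e : E, ∃! p : Γ × ↥EH, p.1 • (p.2 : E) = e) (V₀ : Finset V)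
    (hrep : ∀ v : V, ∃ γ : Γ, ∃ w ∈ V₀, γ • w = v)
    (hrep' : ∀ w₁ ∈ V₀, ∀ w₂ ∈ V₀, (∃ γ : Γ, γ • w₁ = w₂) → w₁ = w₂)
    (g : E → ℂ) (hg : ∀ (γ : Γ) (e : E), g (γ • e) = g e) :
    ∑ v ∈ V₀, ∑ e : {e : E // σ e = v}, g e.val = ∑ e : ↥EH, g e.val := by
  choose p hp hpu using hEH
  rw [← Finset.sum_coe_sort V₀, ← Fintype.sum_sigma']
  refine Fintype.sum_bijective
    (fun x : (v : ↥V₀) × {e : E // σ e = v.val} => (p x.2.val).2) ⟨?_, ?_⟩ _ _ ?_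
  · rintro ⟨⟨v₁, h₁⟩, ⟨e₁, he₁⟩⟩ ⟨⟨v₂, h₂⟩, ⟨e₂, he₂⟩⟩ h
    obtain rfl : σ e₁ = v₁ := he₁
    obtain rfl : σ e₂ = v₂ := he₂
    dsimp only at h
    have he : ((p e₂).1 * (p e₁).1⁻¹) • e₁ = e₂ := by
      have : (p e₁).1⁻¹ • e₁ = (p e₁).2 := inv_smul_eq_iff.2 (hp e₁).symm
      rw [mul_smul, this, h]
      exact hp e₂
    have hv : ((p e₂).1 * (p e₁).1⁻¹) • σ e₁ = σ e₂ := by rw [← hσ, he]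
    have hv' := hrep' _ h₁ _ h₂ ⟨_, hv⟩
    rw [← hv'] at hv
    rw [hfreeV _ _ hv, one_smul] at he
    subst he
    rfl
  · intro e
    obtain ⟨γ, w, hw, hγ⟩ := hrep (σ e.val)
    refine ⟨⟨⟨w, hw⟩, ⟨γ⁻¹ • e.val, ?_⟩⟩, ?_⟩
    · rw [hσ, ← hγ, inv_smul_smul]
    · exact congrArg Prod.snd (hpu (γ⁻¹ • e.val) (γ⁻¹, e) rfl).symm
  · rintro ⟨v, e⟩
    dsimp only
    conv_lhs => rw [← hp e.val]
    exact hg _ _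

variable (s t : E → V) [∀ v : V, Fintype {e : E // s e = v}]
  [∀ v : V, Fintype {e : E // t e = v}]

lemma lapGVec_mem_equivariantSpace (hs : ∀ (γ : Γ) (e : E), s (γ • e) = γ • s e)
    (ht : ∀ (γ : Γ) (e : E), t (γ • e) = γ • t e) (ρ : Γ →* Matrix.unitaryGroup (Fin r) ℂ)
    {F : V → Fin r → ℂ} (hF : F ∈ equivariantSpace r ρ) :
    lapGVec s t r F ∈ equivariantSpace r ρ := by
  intro γ v
  have hdeg : degG s t (γ • v) = degG s t v := by
    rw [degG, degG, Fintype.card_congr (incidenceEquiv s hs γ v),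
      Fintype.card_congr (incidenceEquiv t ht γ v)]
  have h1 : ∑ e : {e : E // s e = γ • v}, F (t e.val) =
      (ρ γ : Matrix (Fin r) (Fin r) ℂ).mulVec (∑ e : {e : E // s e = v}, F (t e.val)) := by
    rw [Matrix.mulVec_sum, ← (incidenceEquiv s hs γ v).sum_comp]
    refine Finset.sum_congr rfl fun e _ => ?_
    rw [← hF γ, ← ht]
    rfl
  have h2 : ∑ e : {e : E // t e = γ • v}, F (s e.val) =
      (ρ γ : Matrix (Fin r) (Fin r) ℂ).mulVec (∑ e : {e : E // t e = v}, F (s e.val)) := by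
    rw [Matrix.mulVec_sum, ← (incidenceEquiv t ht γ v).sum_comp]
    refine Finset.sum_congr rfl fun e _ => ?_
    rw [← hF γ, ← hs]
    rfl
  simp only [lapGVec, LinearMap.coe_mk, AddHom.coe_mk]
  rw [hdeg, h1, h2, hF γ v, Matrix.mulVec_sub, Matrix.mulVec_smul, Matrix.mulVec_add]

lemma degG_ne_zero [DecidableEq V] (hs : ∀ (γ : Γ) (e : E), s (γ • e) = γ • s e)
    (ht : ∀ (γ : Γ) (e : E), t (γ • e) = γ • t e) (EH : Finset E)
    (hcover : ∀ v : V, ∃ γ : Γ, ∃ w ∈ VH s t EH, v = γ • w) (v : V) : degG s t v ≠ 0 := by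
  obtain ⟨γ, w, hw, rfl⟩ := hcover v
  rcases Finset.mem_union.1 hw with h | h
  · obtain ⟨e, -, rfl⟩ := Finset.mem_image.1 h
    have : 0 < Fintype.card {e' : E // s e' = γ • s e} :=
      Fintype.card_pos_iff.2 ⟨⟨γ • e, hs γ e⟩⟩
    rw [degG]
    omega
  · obtain ⟨e, -, rfl⟩ := Finset.mem_image.1 h
    have : 0 < Fintype.card {e' : E // t e' = γ • t e} :=
      Fintype.card_pos_iff.2 ⟨⟨γ • e, ht γ e⟩⟩
    rw [degG]
    omega

lemma degG_mul_star_dotProduct (F G : V → Fin r → ℂ) (v : V) :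
    (degG s t v : ℂ) * (star (F v) ⬝ᵥ G v) =
      (∑ e : {e : E // s e = v}, star (F (s e.val)) ⬝ᵥ G (s e.val)) +
        ∑ e : {e : E // t e = v}, star (F (t e.val)) ⬝ᵥ G (t e.val) := by
  have h1 : ∑ e : {e : E // s e = v}, star (F (s e.val)) ⬝ᵥ G (s e.val) =
      ∑ _e : {e : E // s e = v}, star (F v) ⬝ᵥ G v :=
    Finset.sum_congr rfl fun e _ => by rw [e.2]
  have h2 : ∑ e : {e : E // t e = v}, star (F (t e.val)) ⬝ᵥ G (t e.val) =
      ∑ _e : {e : E // t e = v}, star (F v) ⬝ᵥ G v :=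
    Finset.sum_congr rfl fun e _ => by rw [e.2]
  rw [h1, h2, degG]
  simp [add_mul]

lemma degG_mul_star_lapGVec_dotProduct (F G : V → Fin r → ℂ) (v : V) (hv : degG s t v ≠ 0) :
    (degG s t v : ℂ) * (star (lapGVec s t r F v) ⬝ᵥ G v) =
      (∑ e : {e : E // s e = v}, star (F (s e.val) - F (t e.val)) ⬝ᵥ G (s e.val)) +
        ∑ e : {e : E // t e = v}, star (F (t e.val) - F (s e.val)) ⬝ᵥ G (t e.val) := by
  have h0 : (degG s t v : ℂ) ≠ 0 := Nat.cast_ne_zero.2 hv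
  have h1 : ∑ e : {e : E // s e = v}, star (F (t e.val)) ⬝ᵥ G (s e.val) =
      star (∑ e : {e : E // s e = v}, F (t e.val)) ⬝ᵥ G v := by
    rw [star_sum, sum_dotProduct]
    exact Finset.sum_congr rfl fun e _ => by rw [e.2]
  have h2 : ∑ e : {e : E // t e = v}, star (F (s e.val)) ⬝ᵥ G (t e.val) =
      star (∑ e : {e : E // t e = v}, F (s e.val)) ⬝ᵥ G v := by
    rw [star_sum, sum_dotProduct]
    exact Finset.sum_congr rfl fun e _ => by rw [e.2]
  have h3 := degG_mul_star_dotProduct s t F G v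
  have h4 : lapGVec s t r F v = F v - (degG s t v : ℂ)⁻¹ •
      ((∑ e : {e : E // s e = v}, F (t e.val)) + ∑ e : {e : E // t e = v}, F (s e.val)) := by
    simp [lapGVec]
  simp only [star_sub, sub_dotProduct, Finset.sum_sub_distrib]
  rw [h1, h2, h4, star_sub, star_smul, sub_dotProduct, smul_dotProduct, star_add, add_dotProduct,
    mul_sub, h3]
  simp only [star_inv₀, star_natCast, smul_eq_mul, mul_inv_cancel_left₀ h0]
  ring

/-- The weighted inner product over orbit representatives is a sum over a fundamental domain. -/
lemma sum_degG_mul_star_dotProduct (hs : ∀ (γ : Γ) (e : E), s (γ • e) = γ • s e)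
    (ht : ∀ (γ : Γ) (e : E), t (γ • e) = γ • t e)
    (hfreeV : ∀ (γ : Γ) (v : V), γ • v = v → γ = 1) (EH : Finset E)
    (hEH : ∀ e : E, ∃! p : Γ × ↥EH, p.1 • (p.2 : E) = e) (V₀ : Finset V)
    (hrep : ∀ v : V, ∃ γ : Γ, ∃ w ∈ V₀, γ • w = v)
    (hrep' : ∀ w₁ ∈ V₀, ∀ w₂ ∈ V₀, (∃ γ : Γ, γ • w₁ = w₂) → w₁ = w₂)
    (ρ : Γ →* Matrix.unitaryGroup (Fin r) ℂ) {F G : V → Fin r → ℂ}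
    (hF : F ∈ equivariantSpace r ρ) (hG : G ∈ equivariantSpace r ρ) :
    ∑ v ∈ V₀, (degG s t v : ℂ) * (star (F v) ⬝ᵥ G v) =
      ∑ e : ↥EH, (star (F (s e.val)) ⬝ᵥ G (s e.val) + star (F (t e.val)) ⬝ᵥ G (t e.val)) := by
  simp only [degG_mul_star_dotProduct, Finset.sum_add_distrib]
  rw [sum_sum_incident_eq_sum s hs hfreeV EH hEH V₀ hrep hrep'
      (fun e => star (F (s e)) ⬝ᵥ G (s e)),
    sum_sum_incident_eq_sum t ht hfreeV EH hEH V₀ hrep hrep'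
      (fun e => star (F (t e)) ⬝ᵥ G (t e))]
  · intro γ e
    rw [ht, star_dotProduct_smul_of_mem hF hG]
  · intro γ e
    rw [hs, star_dotProduct_smul_of_mem hF hG]

/-- Discrete Green formula on the space of equivariant functions. -/
lemma sum_degG_mul_star_lapGVec_dotProduct (hs : ∀ (γ : Γ) (e : E), s (γ • e) = γ • s e)
    (ht : ∀ (γ : Γ) (e : E), t (γ • e) = γ • t e)
    (hfreeV : ∀ (γ : Γ) (v : V), γ • v = v → γ = 1) (EH : Finset E)
    (hEH : ∀ e : E, ∃! p : Γ × ↥EH, p.1 • (p.2 : E) = e) (V₀ : Finset V)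
    (hrep : ∀ v : V, ∃ γ : Γ, ∃ w ∈ V₀, γ • w = v)
    (hrep' : ∀ w₁ ∈ V₀, ∀ w₂ ∈ V₀, (∃ γ : Γ, γ • w₁ = w₂) → w₁ = w₂)
    (hdeg : ∀ v, degG s t v ≠ 0)
    (ρ : Γ →* Matrix.unitaryGroup (Fin r) ℂ) {F G : V → Fin r → ℂ}
    (hF : F ∈ equivariantSpace r ρ) (hG : G ∈ equivariantSpace r ρ) :
    ∑ v ∈ V₀, (degG s t v : ℂ) * (star (lapGVec s t r F v) ⬝ᵥ G v) =
      ∑ e : ↥EH, star (F (t e.val) - F (s e.val)) ⬝ᵥ (G (t e.val) - G (s e.val)) := by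
  have h := fun v => degG_mul_star_lapGVec_dotProduct s t F G v (hdeg v)
  simp only [h, Finset.sum_add_distrib]
  rw [sum_sum_incident_eq_sum s hs hfreeV EH hEH V₀ hrep hrep'
      (fun e => star (F (s e) - F (t e)) ⬝ᵥ G (s e)),
    sum_sum_incident_eq_sum t ht hfreeV EH hEH V₀ hrep hrep'
      (fun e => star (F (t e) - F (s e)) ⬝ᵥ G (t e)), ← Finset.sum_add_distrib]
  · refine Finset.sum_congr rfl fun e _ => ?_
    simp only [star_sub, sub_dotProduct, dotProduct_sub]
    ring
  · intro γ e
    simp only [hs, ht, star_sub, sub_dotProduct, star_dotProduct_smul_of_mem hF hG]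
  · intro γ e
    simp only [hs, ht, star_sub, sub_dotProduct, star_dotProduct_smul_of_mem hF hG]

end Equivariant

lemma star_componentwise_endpointValues_dotProduct {U ι : Type*} [Fintype ι] {r : ℕ}
    (σ τ : ι → U) (F G : U → Fin r → ℂ) :
    star (componentwise r (endpointValues σ τ) (components U r F)) ⬝ᵥ
        componentwise r (endpointValues σ τ) (components U r G) =
      ∑ e, (star (F (σ e)) ⬝ᵥ G (σ e) + star (F (τ e)) ⬝ᵥ G (τ e)) := by
  simp only [dotProduct, Fintype.sum_prod_type, Fintype.sum_sum_type, Finset.sum_add_distrib]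
  rw [Finset.sum_comm (s := (univ : Finset ι)), Finset.sum_comm (s := (univ : Finset ι))]
  rfl

lemma star_componentwise_edgeDifference_dotProduct {U ι : Type*} [Fintype ι] {r : ℕ}
    (σ τ : ι → U) (F G : U → Fin r → ℂ) :
    star (componentwise r (edgeDifference σ τ) (components U r F)) ⬝ᵥ
        componentwise r (edgeDifference σ τ) (components U r G) =
      ∑ e, star (F (τ e) - F (σ e)) ⬝ᵥ (G (τ e) - G (σ e)) := by
  simp only [dotProduct, Fintype.sum_prod_type]
  rw [Finset.sum_comm (s := (univ : Finset ι))]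
  rfl

/-- Setting a function on `V_H` to zero outside `V_H`. -/
noncomputable def extendByZeroH [DecidableEq V] (s t : E → V) (EH : Finset E) (r : ℕ) :
    (Fin r → ↥(VH s t EH) → ℂ) →ₗ[ℂ] (V → Fin r → ℂ) where
  toFun f v i := if h : v ∈ VH s t EH then f i ⟨v, h⟩ else 0
  map_add' f g := by
    funext v i
    by_cases h : v ∈ VH s t EH <;> simp [h]
  map_smul' c f := by
    funext v i
    by_cases h : v ∈ VH s t EH <;> simp [h]

lemma extendByZeroH_apply [DecidableEq V] (s t : E → V) (EH : Finset E) {r : ℕ}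
    (f : Fin r → ↥(VH s t EH) → ℂ) (w : ↥(VH s t EH)) (i : Fin r) :
    extendByZeroH s t EH r f w.val i = f i w := dif_pos w.2

lemma finrank_ker_restrict_sub_smul {X : Type*} [AddCommGroup X] [Module ℂ X]
    {p : Submodule ℂ X} {L : X →ₗ[ℂ] X} (h : ∀ x ∈ p, L x ∈ p) (z : ℂ) :
    Module.finrank ℂ (LinearMap.ker (L.restrict h - z • (LinearMap.id : p →ₗ[ℂ] p))) =
      Module.finrank ℂ ↥(p ⊓ LinearMap.ker (L - z • (LinearMap.id : X →ₗ[ℂ] X))) := by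
  have : p ⊓ LinearMap.ker (L - z • (LinearMap.id : X →ₗ[ℂ] X)) =
      (LinearMap.ker (L.restrict h - z • (LinearMap.id : p →ₗ[ℂ] p))).map p.subtype := by
    ext F
    simp only [Submodule.mem_inf, Submodule.mem_map, LinearMap.mem_ker]
    constructor
    · rintro ⟨hF, hz⟩
      exact ⟨⟨F, hF⟩, Subtype.ext hz, rfl⟩
    · rintro ⟨F, hz, rfl⟩
      exact ⟨F.2, congrArg Subtype.val hz⟩
  rw [this]
  exact (Submodule.finrank_map_subtype_eq _ _).symm

/-- **Equivariant eigenvalue bracketing (discrete case).**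
For a `Γ`-periodic graph with fundamental domain `(E_H, V_H, ∂V)`, a set `V₀`
of orbit representatives with `N = |V₀|`, and a unitary representation
`ρ : Γ → U(r)`, the `ρ`-equivariant space `L_ρ` has dimension `rN`, is
invariant under the standard Laplacian `Δ_G`, the restriction of `Δ_G` to `L_ρ`
is self-adjoint for the weighted inner product, and its increasingly ordered
eigenvalues `μ_j^ρ` satisfy `μ_k ≤ μ_j^ρ ≤ μ_k^{∂V}` for `(k−1)r < j ≤ kr`,
i.e. they lie in the discrete Kirchhoff–Dirichlet intervals of the fundamental
domain (with the convention `μ_k^{∂V} = 2` for `k > |V_H| − |∂V|`). -/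
theorem equivariant_eigenvalue_bracketing
    {Γ : Type*} [Group Γ] [DecidableEq V] [DecidableEq E]
    [MulAction Γ V] [MulAction Γ E]
    (s t : E → V)
    (hs : ∀ (γ : Γ) (e : E), s (γ • e) = γ • s e)
    (ht : ∀ (γ : Γ) (e : E), t (γ • e) = γ • t e)
    (hfreeV : ∀ (γ : Γ) (v : V), γ • v = v → γ = 1)
    (hfreeE : ∀ (γ : Γ) (e : E), γ • e = e → γ = 1)
    (hOrbV : Finite (Quotient (MulAction.orbitRel Γ V)))
    (hOrbE : Finite (Quotient (MulAction.orbitRel Γ E)))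
    [∀ v : V, Fintype {e : E // s e = v}] [∀ v : V, Fintype {e : E // t e = v}]
    (EH : Finset E)
    (hEH : ∀ e : E, ∃! p : Γ × ↥EH, p.1 • (p.2 : E) = e)
    (bd : Finset V) (hbdsub : bd ⊆ VH s t EH)
    (hinner : ∀ v ∈ VH s t EH \ bd, ∀ e : E, (s e = v ∨ t e = v) → e ∈ EH)
    (hdisj : ∀ (γ₁ γ₂ : Γ) (v₁ v₂ : V), v₁ ∈ VH s t EH \ bd → v₂ ∈ VH s t EH \ bd →
      γ₁ • v₁ = γ₂ • v₂ → γ₁ = γ₂)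
    (hcover : ∀ v : V, ∃ γ : Γ, ∃ w ∈ VH s t EH, v = γ • w)
    (V₀ : Finset V)
    (hrep : ∀ v : V, ∃ γ : Γ, ∃ w ∈ V₀, γ • w = v)
    (hrep' : ∀ w₁ ∈ V₀, ∀ w₂ ∈ V₀, (∃ γ : Γ, γ • w₁ = w₂) → w₁ = w₂)
    (r : ℕ) (hr : 1 ≤ r) (ρ : Γ →* Matrix.unitaryGroup (Fin r) ℂ)
    (μ : Fin ((VH s t EH).card) → ℝ) (hmono : Monotone μ)
    (hcount : ∀ x : ℝ, (univ.filter fun i => μ i = x).card =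
      Module.finrank ℂ (LinearMap.ker (lapH s t EH -
        (x : ℂ) • (LinearMap.id : (↥(VH s t EH) → ℂ) →ₗ[ℂ] (↥(VH s t EH) → ℂ)))))
    (μD : Fin ((VH s t EH).card - bd.card) → ℝ) (hmonoD : Monotone μD)
    (hcountD : ∀ x : ℝ, (univ.filter fun i => μD i = x).card =
      Module.finrank ℂ (LinearMap.ker (dirLapH s t EH bd -
        (x : ℂ) • (LinearMap.id : dirDomH s t EH bd →ₗ[ℂ] dirDomH s t EH bd))))
    (μρ : Fin (r * V₀.card) → ℝ) (hρmono : Monotone μρ)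
    (hρcount : ∀ x : ℝ, (univ.filter fun j => μρ j = x).card =
      Module.finrank ℂ ↥(equivariantSpace (V := V) r ρ ⊓
        LinearMap.ker (lapGVec s t r -
          (x : ℂ) • (LinearMap.id : (V → Fin r → ℂ) →ₗ[ℂ] (V → Fin r → ℂ))))) :
    Module.finrank ℂ (equivariantSpace (V := V) r ρ) = r * V₀.card ∧
    (∀ F ∈ equivariantSpace (V := V) r ρ, lapGVec s t r F ∈ equivariantSpace (V := V) r ρ) ∧
    (∀ F ∈ equivariantSpace (V := V) r ρ, ∀ G ∈ equivariantSpace (V := V) r ρ,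
      (∑ v ∈ V₀, (degG s t v : ℂ) *
          ∑ i : Fin r, (starRingEnd ℂ) ((lapGVec s t r F) v i) * G v i) =
        ∑ v ∈ V₀, (degG s t v : ℂ) *
          ∑ i : Fin r, (starRingEnd ℂ) (F v i) * (lapGVec s t r G) v i) ∧
    (∀ (k : Fin ((VH s t EH).card)) (j : Fin (r * V₀.card)),
      (k : ℕ) * r ≤ (j : ℕ) → (j : ℕ) < ((k : ℕ) + 1) * r →
        μ k ≤ μρ j ∧
          μρ j ≤ (if h : (k : ℕ) < (VH s t EH).card - bd.card then μD ⟨k, h⟩ else 2)) := by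
  have hdeg := degG_ne_zero s t hs ht EH hcover
  have hinv : ∀ F ∈ equivariantSpace (V := V) r ρ,
      lapGVec s t r F ∈ equivariantSpace (V := V) r ρ :=
    fun F hF => lapGVec_mem_equivariantSpace s t hs ht ρ hF
  have hgreen : ∀ F ∈ equivariantSpace (V := V) r ρ, ∀ G ∈ equivariantSpace (V := V) r ρ,
      ∑ v ∈ V₀, (degG s t v : ℂ) * (star (lapGVec s t r F v) ⬝ᵥ G v) =
        ∑ e : ↥EH, star (F (t e.val) - F (s e.val)) ⬝ᵥ (G (t e.val) - G (s e.val)) :=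
    fun F hF G hG => sum_degG_mul_star_lapGVec_dotProduct s t hs ht hfreeV EH hEH V₀ hrep hrep'
      hdeg ρ hF hG
  refine ⟨finrank_equivariantSpace ρ hfreeV V₀ hrep hrep', hinv, fun F hF G hG => ?_, ?_⟩
  · have h1 := hgreen F hF G hG
    have h2 := congrArg star (hgreen G hG F hF)
    simp only [star_sum, star_mul', ← Matrix.star_dotProduct, star_natCast] at h2
    exact h1.trans h2.symm
  let σ : ↥EH → V := fun e => s e.val
  let τ : ↥EH → V := fun e => t e.val
  let C : equivariantSpace (V := V) r ρ →ₗ[ℂ] (Fin r → V → ℂ) :=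
    components V r ∘ₗ (equivariantSpace r ρ).subtype
  let a := componentwise r (endpointValues σ τ) ∘ₗ C
  let d := componentwise r (edgeDifference σ τ) ∘ₗ C
  let T : equivariantSpace (V := V) r ρ →ₗ[ℂ] equivariantSpace (V := V) r ρ :=
    (lapGVec s t r).restrict hinv
  have ha : Function.Injective a := by
    intro F G h
    apply Subtype.ext
    funext v
    obtain ⟨γ, w, hw, rfl⟩ := hcover v
    have hFG : F.val w = G.val w := by
      funext i
      obtain ⟨x, hx⟩ := exists_endpoint_eq s t EH ⟨w, hw⟩
      have hx' : Sum.elim σ τ x = w := by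
        refine Eq.trans ?_ (congrArg Subtype.val hx)
        cases x <;> rfl
      rw [← hx']
      exact congrFun h (i, x)
    rw [F.2 γ w, G.2 γ w, hFG]
  have hT : ∀ F G, star (a (T F)) ⬝ᵥ a G = star (d F) ⬝ᵥ d G := by
    intro F G
    refine (star_componentwise_endpointValues_dotProduct σ τ (T F).val G.val).trans ?_
    refine Eq.trans ?_ (star_componentwise_edgeDifference_dotProduct σ τ F.val G.val).symm
    rw [← hgreen F.val F.2 G.val G.2]
    exact (sum_degG_mul_star_dotProduct s t hs ht hfreeV EH hEH V₀ hrep hrep' ρ (T F).2 G.2).symm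
  obtain ⟨Qρ, hQρ⟩ := exists_diagonalizing_coordinates a ha d T hT μρ fun x => by
    rw [hρcount x, finrank_ker_restrict_sub_smul]
  obtain ⟨Q, hQ⟩ := exists_diagonalizing_coordinates _ (endpointValues_injective s t EH) _ _
    (star_endpointValues_lapH_dotProduct s t EH) μ hcount
  obtain ⟨QD, hQD⟩ := exists_diagonalizing_coordinates
    (endpointValues (sourceH s t EH) (targetH s t EH) ∘ₗ (dirDomH s t EH bd).subtype)
    ((endpointValues_injective s t EH).comp Subtype.val_injective)
    (edgeDifference (sourceH s t EH) (targetH s t EH) ∘ₗ (dirDomH s t EH bd).subtype)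
    (dirLapH s t EH bd) (star_endpointValues_dirLapH_dotProduct s t EH bd) μD hcountD
  have hQρ1 : ∀ F : equivariantSpace (V := V) r ρ, ∑ l, ‖Qρ F l‖ ^ 2 =
      ∑ i, ∑ x, ‖endpointValues σ τ (C F i) x‖ ^ 2 := by
    intro F
    rw [← (hQρ F).1, Fintype.sum_prod_type]
    rfl
  have hQρ2 : ∀ F : equivariantSpace (V := V) r ρ, ∑ l, μρ l * ‖Qρ F l‖ ^ 2 =
      ∑ i, ∑ e, ‖edgeDifference σ τ (C F i) e‖ ^ 2 := by
    intro F
    rw [← (hQρ F).2, Fintype.sum_prod_type]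
    rfl
  have hend : ∀ (f : V → ℂ) (g : ↥(VH s t EH) → ℂ), (∀ w, f w.val = g w) →
      endpointValues σ τ f = endpointValues (sourceH s t EH) (targetH s t EH) g := by
    intro f g h
    funext x
    rcases x with e | e
    · exact h (sourceH s t EH e)
    · exact h (targetH s t EH e)
  have hdiff : ∀ (f : V → ℂ) (g : ↥(VH s t EH) → ℂ), (∀ w, f w.val = g w) →
      edgeDifference σ τ f = edgeDifference (sourceH s t EH) (targetH s t EH) g := by
    intro f g h
    funext e
    exact congrArg₂ (· - ·) (h (targetH s t EH e)) (h (sourceH s t EH e))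
  intro k j hkj hjk
  constructor
  · let R : equivariantSpace (V := V) r ρ →ₗ[ℂ] (Fin r → ↥(VH s t EH) → ℂ) :=
      LinearMap.pi fun i => LinearMap.funLeft ℂ ℂ Subtype.val ∘ₗ LinearMap.proj i ∘ₗ C
    let J : (Fin (r * V₀.card) → ℂ) →ₗ[ℂ] (Fin r × Fin (VH s t EH).card → ℂ) :=
      (componentwiseEquiv r Q).toLinearMap ∘ₗ R ∘ₗ Qρ.symm.toLinearMap
    have hJ : ∀ c p, J c p = Q (R (Qρ.symm c) p.1) p.2 := fun _ _ => rfl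
    refine le_of_card_lt_card_of_diagonal J μρ (fun p => μ p.2) ?_ ?_ _ _ ?_
    · intro c
      have h := hQρ1 (Qρ.symm c)
      rw [LinearEquiv.apply_symm_apply] at h
      simp only [h, hJ, Fintype.sum_prod_type]
      refine Finset.sum_congr rfl fun i _ => ?_
      rw [← (hQ _).1, hend _ (R (Qρ.symm c) i) fun _ => rfl]
    · intro c
      have h := hQρ2 (Qρ.symm c)
      rw [LinearEquiv.apply_symm_apply] at h
      simp only [h, hJ, Fintype.sum_prod_type]
      refine Finset.sum_congr rfl fun i _ => ?_
      rw [← (hQ _).2, hdiff _ (R (Qρ.symm c) i) fun _ => rfl]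
    · rw [card_filter_snd fun l => μ l < μ k, Fintype.card_fin]
      calc r * (univ.filter fun l => μ l < μ k).card ≤ r * k :=
          Nat.mul_le_mul_left r (card_filter_lt_le_of_monotone hmono k)
        _ ≤ j := (mul_comm _ _).trans_le hkj
        _ < _ := lt_card_filter_le_of_monotone hρmono j
  split_ifs with hk
  · let S : Set V := ↑(VH s t EH \ bd)
    have hS : ∀ γ₁ γ₂ : Γ, ∀ v₁ ∈ S, ∀ v₂ ∈ S, γ₁ • v₁ = γ₂ • v₂ → γ₁ = γ₂ :=
      fun γ₁ γ₂ v₁ h₁ v₂ h₂ h => hdisj γ₁ γ₂ v₁ v₂ h₁ h₂ h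
    have hbd : ∀ w ∈ VH s t EH, w ∈ bd → ∀ γ : Γ, ∀ v ∈ S, γ • v ≠ w := by
      rintro w hw hwbd γ v hv rfl
      obtain ⟨e, he, hinc⟩ : ∃ e ∈ EH, s e = γ • v ∨ t e = γ • v := by
        rcases Finset.mem_union.1 hw with h | h
        · obtain ⟨e, he, h⟩ := Finset.mem_image.1 h
          exact ⟨e, he, Or.inl h⟩
        · obtain ⟨e, he, h⟩ := Finset.mem_image.1 h
          exact ⟨e, he, Or.inr h⟩
      have he' : γ⁻¹ • e ∈ EH := by
        refine hinner v hv _ ?_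
        rw [hs, ht, inv_smul_eq_iff, inv_smul_eq_iff]
        exact hinc
      have hp := (hEH e).unique (y₁ := (γ, ⟨γ⁻¹ • e, he'⟩)) (y₂ := (1, ⟨e, he⟩))
        (smul_inv_smul γ e) (one_smul Γ e)
      have hγ : γ = 1 := congrArg Prod.fst hp
      rw [hγ, one_smul] at hwbd
      exact (Finset.mem_sdiff.1 hv).2 hwbd
    let X : (Fin r → dirDomH s t EH bd) →ₗ[ℂ] equivariantSpace (V := V) r ρ :=
      ((equivariantExtension ρ S).codRestrict _ (equivariantExtension_mem ρ hS)) ∘ₗ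
        extendByZeroH s t EH r ∘ₗ
          LinearMap.pi fun i => (dirDomH s t EH bd).subtype ∘ₗ LinearMap.proj i
    have hX : ∀ f i (w : ↥(VH s t EH)), C (X f) i w.val = (f i).val w := by
      intro f i w
      change equivariantExtension ρ S
        (extendByZeroH s t EH r fun i => (f i).val) w.val i = (f i).val w
      by_cases hw : w.val ∈ bd
      · rw [equivariantExtension_of_notMem ρ _ (hbd w.val w.2 hw), (f i).2 w hw]
        rfl
      · rw [equivariantExtension_apply ρ hS _ (Finset.mem_sdiff.2 ⟨w.2, hw⟩),
          extendByZeroH_apply]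
    let J : (Fin r × Fin ((VH s t EH).card - bd.card) → ℂ) →ₗ[ℂ] (Fin (r * V₀.card) → ℂ) :=
      Qρ.toLinearMap ∘ₗ X ∘ₗ (componentwiseEquiv r QD).symm.toLinearMap
    refine le_of_card_lt_card_of_diagonal J (fun p => μD p.2) μρ ?_ ?_ _ _ ?_
    · intro c
      obtain ⟨f, rfl⟩ := (componentwiseEquiv r QD).surjective c
      have hJ : J (componentwiseEquiv r QD f) = Qρ (X f) := by simp [J]
      rw [hJ, hQρ1, Fintype.sum_prod_type]
      refine Finset.sum_congr rfl fun i _ => ?_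
      rw [hend _ _ (hX f i)]
      exact (hQD (f i)).1
    · intro c
      obtain ⟨f, rfl⟩ := (componentwiseEquiv r QD).surjective c
      have hJ : J (componentwiseEquiv r QD f) = Qρ (X f) := by simp [J]
      rw [hJ, hQρ2, Fintype.sum_prod_type]
      refine Finset.sum_congr rfl fun i _ => ?_
      rw [hdiff _ _ (hX f i)]
      exact (hQD (f i)).2
    · rw [card_filter_snd fun l => μD l ≤ μD ⟨k, hk⟩, Fintype.card_fin]
      calc (univ.filter fun l => μρ l < μρ j).card ≤ j := card_filter_lt_le_of_monotone hρmono j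
        _ < r * (k + 1) := hjk.trans_eq (mul_comm _ _)
        _ ≤ _ := Nat.mul_le_mul_left r (lt_card_filter_le_of_monotone hmonoD ⟨k, hk⟩)
  · have h1 := hQρ1 (Qρ.symm (Pi.single j 1))
    have h2 := hQρ2 (Qρ.symm (Pi.single j 1))
    have h3 : ∑ l, ‖(Pi.single j 1 : Fin (r * V₀.card) → ℂ) l‖ ^ 2 = 1 := by
      rw [Finset.sum_eq_single j] <;> simp +contextual
    have h4 : ∑ l, μρ l * ‖(Pi.single j 1 : Fin (r * V₀.card) → ℂ) l‖ ^ 2 = μρ j := by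
      rw [Finset.sum_eq_single j] <;> simp +contextual
    rw [LinearEquiv.apply_symm_apply, h3] at h1
    rw [LinearEquiv.apply_symm_apply, h4] at h2
    calc μρ j = _ := h2
      _ ≤ ∑ i, 2 * ∑ x, ‖endpointValues σ τ (C (Qρ.symm (Pi.single j 1)) i) x‖ ^ 2 :=
          Finset.sum_le_sum fun i _ => sum_norm_sq_edgeDifference_le σ τ _
      _ = 2 := by rw [← Finset.mul_sum, ← h1, mul_one]
end
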